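/- arXiv:2512.13952 — 2 statements merged into one kernel-verified Lean document; each statement's English description precedes it below -/
import Mathlib

section
/- Reverse Poincaré inequality for bicaloric functions in Euclidean space (Lemma 2.1, Euclidean case K = 0): For every integer n ≥ 1 and every ε ∈ (0,1) there is a constant c = c(n,ε) > 0 with the following property. Let p ∈ ℝⁿ, r > 0, and let u : ℝⁿ × ℝ → ℝ be smooth and satisfy ∂_t u + ΔΔu = 0 on ℝⁿ × [−r⁴, 0]. Then r⁴·(∫_{Q_{εr}(p)} |∇²u|² + r²·∫_{Q_{εr}(p)} |∇Δu|²) + r⁸·(∫_{Q_{εr}(p)} (∂_t u)² + r²·∫_{Q_{εr}(p)} |∇∂_t u|²) ≤ c·(∫_{Q_r(p)} u² + r²·∫_{Q_r(p)} |∇u|²). -/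
open Set Metric MeasureTheory

noncomputable section

/-- The Euclidean Laplacian of `f : ℝⁿ → ℝ`. -/
def lapE (n : ℕ) (f : EuclideanSpace ℝ (Fin n) → ℝ) (x : EuclideanSpace ℝ (Fin n)) : ℝ :=
  ∑ i : Fin n, fderiv ℝ (fun y => fderiv ℝ f y (EuclideanSpace.single i 1)) x
    (EuclideanSpace.single i 1)

/-- The squared Hilbert–Schmidt norm of the Hessian of `f : ℝⁿ → ℝ`. -/
def hessNormSq (n : ℕ) (f : EuclideanSpace ℝ (Fin n) → ℝ) (x : EuclideanSpace ℝ (Fin n)) : ℝ :=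
  ∑ i : Fin n, ∑ j : Fin n,
    (fderiv ℝ (fun y => fderiv ℝ f y (EuclideanSpace.single j 1)) x
      (EuclideanSpace.single i 1)) ^ 2

/-- The spatial Laplacian of `u : ℝⁿ × ℝ → ℝ`. -/
def slap (n : ℕ) (u : EuclideanSpace ℝ (Fin n) × ℝ → ℝ) :
    EuclideanSpace ℝ (Fin n) × ℝ → ℝ :=
  fun z => lapE n (fun y => u (y, z.2)) z.1

/-- The time derivative of `u : ℝⁿ × ℝ → ℝ`. -/
def tderiv (n : ℕ) (u : EuclideanSpace ℝ (Fin n) × ℝ → ℝ) :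
    EuclideanSpace ℝ (Fin n) × ℝ → ℝ :=
  fun z => deriv (fun s => u (z.1, s)) z.2

/-- The spatial gradient of `u : ℝⁿ × ℝ → ℝ`. -/
def sgrad (n : ℕ) (u : EuclideanSpace ℝ (Fin n) × ℝ → ℝ) :
    EuclideanSpace ℝ (Fin n) × ℝ → EuclideanSpace ℝ (Fin n) :=
  fun z => gradient (fun y => u (y, z.2)) z.1

/-- The squared Hilbert–Schmidt norm of the spatial Hessian of `u : ℝⁿ × ℝ → ℝ`. -/
def shessNormSq (n : ℕ) (u : EuclideanSpace ℝ (Fin n) × ℝ → ℝ) :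
    EuclideanSpace ℝ (Fin n) × ℝ → ℝ :=
  fun z => hessNormSq n (fun y => u (y, z.2)) z.1

/-- The heat ball `Q_r(p) = B_r(p) × [-r⁴, 0]`. -/
def heatBall (n : ℕ) (p : EuclideanSpace ℝ (Fin n)) (r : ℝ) :
    Set (EuclideanSpace ℝ (Fin n) × ℝ) :=
  Metric.ball p r ×ˢ Set.Icc (-(r ^ 4)) 0

/-- `u` solves the biharmonic heat equation `∂ₜ u + ΔΔ u = 0` on `ℝⁿ × [-r⁴, 0]`. -/
def BicaloricOn (n : ℕ) (u : EuclideanSpace ℝ (Fin n) × ℝ → ℝ) (r : ℝ) : Prop :=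
  ∀ (x : EuclideanSpace ℝ (Fin n)), ∀ t ∈ Set.Icc (-(r ^ 4)) (0 : ℝ),
    tderiv n u (x, t) + slap n (slap n u) (x, t) = 0

/-- `u ∈ 𝒫_{d,d'}(ℝⁿ)`: a smooth ancient solution of the biharmonic heat equation with
`sup_{Q_R(p)} |u| ≤ C (1+R)^d` and `sup_{Q_R(p)} |∇u| ≤ C' (1+R)^{d'}`. -/
def PolyCaloric (n : ℕ) (d d' : ℝ) (u : EuclideanSpace ℝ (Fin n) × ℝ → ℝ) : Prop :=
  ContDiff ℝ (⊤ : ℕ∞) u ∧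
  (∀ (x : EuclideanSpace ℝ (Fin n)), ∀ t ≤ (0 : ℝ),
    tderiv n u (x, t) + slap n (slap n u) (x, t) = 0) ∧
  (∃ C : ℝ, 0 < C ∧ ∀ (p : EuclideanSpace ℝ (Fin n)) (R : ℝ), 0 < R →
    ∀ z ∈ heatBall n p R, |u z| ≤ C * (1 + R) ^ d) ∧
  (∃ C' : ℝ, 0 < C' ∧ ∀ (p : EuclideanSpace ℝ (Fin n)) (R : ℝ), 0 < R →
    ∀ z ∈ heatBall n p R, ‖sgrad n u z‖ ≤ C' * (1 + R) ^ d')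

/-- `u ∈ ℋ_{d,d'}(ℝⁿ)`: a smooth biharmonic function with `sup_{B_R(p)} |u| ≤ C (1+R)^d`
and `sup_{B_R(p)} |∇u| ≤ C' (1+R)^{d'}`. -/
def PolyBiharmonic (n : ℕ) (d d' : ℝ) (u : EuclideanSpace ℝ (Fin n) → ℝ) : Prop :=
  ContDiff ℝ (⊤ : ℕ∞) u ∧
  (∀ x, lapE n (lapE n u) x = 0) ∧
  (∃ C : ℝ, 0 < C ∧ ∀ (p : EuclideanSpace ℝ (Fin n)) (R : ℝ), 0 < R →
    ∀ x ∈ Metric.ball p R, |u x| ≤ C * (1 + R) ^ d) ∧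
  (∃ C' : ℝ, 0 < C' ∧ ∀ (p : EuclideanSpace ℝ (Fin n)) (R : ℝ), 0 < R →
    ∀ x ∈ Metric.ball p R, ‖gradient u x‖ ≤ C' * (1 + R) ^ d')

/-- The set `𝒫_{d,d'}(ℝⁿ)`. -/
def Pset (n : ℕ) (d d' : ℝ) : Set (EuclideanSpace ℝ (Fin n) × ℝ → ℝ) :=
  {u | PolyCaloric n d d' u}

/-- The set `ℋ_{d,d'}(ℝⁿ)`. -/
def Hset (n : ℕ) (d d' : ℝ) : Set (EuclideanSpace ℝ (Fin n) → ℝ) :=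
  {u | PolyBiharmonic n d d' u}


/-! ### Directional derivatives on space-time -/

/-- Directional derivative. -/
def Dv {X : Type*} [NormedAddCommGroup X] [NormedSpace ℝ X] (v : X) (f : X → ℝ) : X → ℝ :=
  fun z => fderiv ℝ f z v

/-- Smoothness. -/
abbrev Sm {X : Type*} [NormedAddCommGroup X] [NormedSpace ℝ X] (f : X → ℝ) : Prop :=
  ContDiff ℝ ((⊤ : ℕ∞) : WithTop ℕ∞) f

section calculus
variable {X : Type*} [NormedAddCommGroup X] [NormedSpace ℝ X]

lemma Sm.diff {f : X → ℝ} (hf : Sm f) : Differentiable ℝ f :=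
  ContDiff.differentiable hf (by simp)

lemma Sm.dv {f : X → ℝ} (hf : Sm f) (v : X) : Sm (Dv v f) := by
  have h : ContDiff ℝ ((⊤ : ℕ∞) : WithTop ℕ∞) (fderiv ℝ f) :=
    ContDiff.fderiv_right (m := ((⊤ : ℕ∞) : WithTop ℕ∞)) hf (by simp)
  exact h.clm_apply contDiff_const

lemma Dv_mul {f g : X → ℝ} (hf : Sm f) (hg : Sm g) (v : X) (z : X) :
    Dv v (fun y => f y * g y) z = f z * Dv v g z + Dv v f z * g z := by
  unfold Dv
  rw [fderiv_fun_mul (hf.diff z) (hg.diff z)]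
  simp; ring

lemma Dv_add {f g : X → ℝ} (hf : Sm f) (hg : Sm g) (v : X) (z : X) :
    Dv v (fun y => f y + g y) z = Dv v f z + Dv v g z := by
  unfold Dv
  rw [fderiv_fun_add (hf.diff z) (hg.diff z)]
  simp

lemma Dv_sub {f g : X → ℝ} (hf : Sm f) (hg : Sm g) (v : X) (z : X) :
    Dv v (fun y => f y - g y) z = Dv v f z - Dv v g z := by
  unfold Dv
  rw [fderiv_fun_sub (hf.diff z) (hg.diff z)]
  simp

lemma Dv_pow {f : X → ℝ} (hf : Sm f) (k : ℕ) (v : X) (z : X) :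
    Dv v (fun y => f y ^ k) z = k * f z ^ (k-1) * Dv v f z := by
  unfold Dv
  rw [fderiv_fun_pow k (hf.diff z)]
  simp

lemma Dv_sum {ι : Type*} (s : Finset ι) {f : ι → X → ℝ} (hf : ∀ i, Sm (f i)) (v : X) (z : X) :
    Dv v (fun y => ∑ i ∈ s, f i y) z = ∑ i ∈ s, Dv v (f i) z := by
  unfold Dv
  rw [fderiv_fun_sum (fun i _ => (hf i).diff z)]
  simp

lemma Dv_comm {f : X → ℝ} (hf : Sm f) (v w : X) : Dv v (Dv w f) = Dv w (Dv v f) := by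
  funext z
  have h : ContDiff ℝ ((⊤ : ℕ∞) : WithTop ℕ∞) (fderiv ℝ f) :=
    ContDiff.fderiv_right (m := ((⊤ : ℕ∞) : WithTop ℕ∞)) hf (by simp)
  have hd : DifferentiableAt ℝ (fderiv ℝ f) z := (h.differentiable (by simp)) z
  have hs : IsSymmSndFDerivAt ℝ f z := (hf.contDiffAt).isSymmSndFDerivAt (by
    simp only [minSmoothness_of_isRCLikeNormedField]
    exact WithTop.coe_le_coe.2 le_top)
  have key : ∀ a b : X, Dv a (Dv b f) z = fderiv ℝ (fderiv ℝ f) z a b := by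
    intro a b
    unfold Dv
    rw [fderiv_clm_apply hd (by fun_prop)]
    simp
  rw [key, key]
  exact hs v w

end calculus

/-- Space-time. -/
abbrev SpT (n : ℕ) := EuclideanSpace ℝ (Fin n) × ℝ

/-- basis direction -/
abbrev ed {n : ℕ} (i : Fin n) : SpT n := (EuclideanSpace.single i 1, 0)

/-- time direction -/
abbrev td (n : ℕ) : SpT n := (0, 1)

/-- Laplacian with space-time derivatives -/
def Lpl {n : ℕ} (f : SpT n → ℝ) : SpT n → ℝ := fun z => ∑ i, Dv (ed i) (Dv (ed i) f) z

section bridge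
variable {n : ℕ}

lemma slice_fderiv {f : SpT n → ℝ} (hf : Sm f) (x : EuclideanSpace ℝ (Fin n)) (t : ℝ)
    (v : EuclideanSpace ℝ (Fin n)) :
    fderiv ℝ (fun y => f (y, t)) x v = Dv (v, 0) f (x, t) := by
  have h1 : HasFDerivAt (fun y : EuclideanSpace ℝ (Fin n) => (y, t))
      (ContinuousLinearMap.inl ℝ (EuclideanSpace ℝ (Fin n)) ℝ) x := hasFDerivAt_prodMk_left x t
  have h2 := ((hf.diff (x, t)).hasFDerivAt).comp x h1
  have : fderiv ℝ (fun y => f (y, t)) x = _ := h2.fderiv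
  rw [this]
  simp [Dv]

lemma Sm.lp {f : SpT n → ℝ} (hf : Sm f) : Sm (Lpl f) :=
  ContDiff.sum fun i _ => (hf.dv _).dv _

lemma slap_eq {f : SpT n → ℝ} (hf : Sm f) : slap n f = Lpl f := by
  funext z
  unfold slap lapE Lpl
  refine Finset.sum_congr rfl fun i _ => ?_
  have : (fun y => fderiv ℝ (fun y => f (y, z.2)) y (EuclideanSpace.single i 1)) =
      fun y => Dv (ed i) f (y, z.2) := by
    funext y; exact slice_fderiv hf y z.2 _
  rw [this]
  exact slice_fderiv (hf.dv _) z.1 z.2 _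

lemma shess_eq {f : SpT n → ℝ} (hf : Sm f) (z : SpT n) :
    shessNormSq n f z = ∑ i, ∑ j, (Dv (ed i) (Dv (ed j) f) z) ^ 2 := by
  unfold shessNormSq hessNormSq
  refine Finset.sum_congr rfl fun i _ => Finset.sum_congr rfl fun j _ => ?_
  have : (fun y => fderiv ℝ (fun y => f (y, z.2)) y (EuclideanSpace.single j 1)) =
      fun y => Dv (ed j) f (y, z.2) := by
    funext y; exact slice_fderiv hf y z.2 _
  rw [this]
  congr 1
  exact slice_fderiv (hf.dv _) z.1 z.2 _

lemma tderiv_eq {f : SpT n → ℝ} (hf : Sm f) : tderiv n f = Dv (td n) f := by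
  funext z
  unfold tderiv
  have h1 : HasDerivAt (fun s : ℝ => (z.1, s)) (td n) z.2 :=
    (hasDerivAt_const z.2 z.1).prodMk (hasDerivAt_id z.2)
  have h2 := HasFDerivAt.comp_hasDerivAt z.2 ((hf.diff (z.1, z.2)).hasFDerivAt) h1
  exact h2.deriv

lemma sgrad_eq {f : SpT n → ℝ} (hf : Sm f) (z : SpT n) :
    ‖sgrad n f z‖ ^ 2 = ∑ i, (Dv (ed i) f z) ^ 2 := by
  rw [EuclideanSpace.norm_sq_eq]
  refine Finset.sum_congr rfl fun i _ => ?_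
  have h : sgrad n f z i = Dv (ed i) f z := by
    rw [← slice_fderiv hf z.1 z.2]
    have : inner ℝ (gradient (fun y => f (y, z.2)) z.1) (EuclideanSpace.single i (1:ℝ)) =
      fderiv ℝ (fun y => f (y, z.2)) z.1 (EuclideanSpace.single i 1) := by
      simp [gradient]
    rw [← this, EuclideanSpace.inner_single_right]
    simp [sgrad]
  rw [h, Real.norm_eq_abs, sq_abs]

lemma Dv_Lp {f : SpT n → ℝ} (hf : Sm f) (v : SpT n) : Dv v (Lpl f) = Lpl (Dv v f) := by
  funext z
  unfold Lpl
  rw [Dv_sum _ (fun i => (hf.dv _).dv _)]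
  refine Finset.sum_congr rfl fun i _ => ?_
  rw [Dv_comm (hf.dv _), Dv_comm hf]

/-- solves the equation on a time interval -/
def Bic (S : ℝ) (f : SpT n → ℝ) : Prop :=
  ∀ x : EuclideanSpace ℝ (Fin n), ∀ t ∈ Set.Icc (-S) (0:ℝ), Dv (td n) f (x, t) + Lpl (Lpl f) (x, t) = 0

lemma Dv_slice_zero {f : SpT n → ℝ} (hf : Sm f) {t : ℝ} (h : ∀ x, f (x, t) = 0) (i : Fin n)
    (x : EuclideanSpace ℝ (Fin n)) : Dv (ed i) f (x, t) = 0 := by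
  rw [← slice_fderiv hf]
  have : (fun y => f (y, t)) = fun _ => 0 := by funext y; exact h y
  rw [this]; simp

lemma Bic.dv {S : ℝ} {f : SpT n → ℝ} (hf : Sm f) (h : Bic S f) (i : Fin n) :
    Bic S (Dv (ed i) f) := by
  intro x t ht
  have h0 := Dv_slice_zero (f := fun z => Dv (td n) f z + Lpl (Lpl f) z)
    ((hf.dv _).add hf.lp.lp) (t := t) (fun x => h x t ht) i x
  rw [Dv_add (hf.dv _) hf.lp.lp, Dv_comm hf, Dv_Lp hf.lp, Dv_Lp hf] at h0
  exact h0

lemma Bic.lp {S : ℝ} {f : SpT n → ℝ} (hf : Sm f) (h : Bic S f) : Bic S (Lpl f) := by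
  intro x t ht
  have h2 : ∀ i, Bic S (Dv (ed i) (Dv (ed i) f)) := fun i => (h.dv hf i).dv (hf.dv _) i
  have h3 : ∑ i, (Dv (td n) (Dv (ed i) (Dv (ed i) f)) (x, t)
      + Lpl (Lpl (Dv (ed i) (Dv (ed i) f))) (x,t)) = 0 :=
    Finset.sum_eq_zero fun i _ => h2 i x t ht
  rw [Finset.sum_add_distrib] at h3
  have h4 : Dv (td n) (Lpl f) (x, t) = ∑ i, Dv (td n) (Dv (ed i) (Dv (ed i) f)) (x, t) :=
    Dv_sum _ (fun i => (hf.dv _).dv _) _ _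
  have h5 : Lpl (Lpl (Lpl f)) (x, t) = ∑ i, Lpl (Lpl (Dv (ed i) (Dv (ed i) f))) (x,t) := by
    conv_lhs => unfold Lpl
    refine Finset.sum_congr rfl fun i _ => ?_
    have : (fun z => ∑ i, Dv (ed i) (Dv (ed i) (Lpl f)) z) = Lpl (Lpl f) := rfl
    have e1 : ∀ j : Fin n, Dv (ed j) (Lpl f) = Lpl (Dv (ed j) f) := fun j => Dv_Lp hf _
    change Dv (ed i) (Dv (ed i) (Lpl (Lpl f))) (x, t) = _
    rw [Dv_Lp hf.lp, Dv_Lp hf, Dv_Lp (hf.dv _).lp, Dv_Lp (hf.dv _)]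
  rw [h4, h5]; exact h3

end bridge

/-! ### Integration on the space-time slab -/

section slab
variable {n : ℕ}

/-- Lebesgue measure on the slab `ℝⁿ × [-S, 0]`. -/
def slabM (n : ℕ) (S : ℝ) : Measure (SpT n) :=
  (volume : Measure (EuclideanSpace ℝ (Fin n))).prod (volume.restrict (Set.Icc (-S) 0))

lemma slabM_eq (S : ℝ) : slabM n S = (volume : Measure (SpT n)).restrict
    (Set.univ ×ˢ Set.Icc (-S) (0:ℝ)) := by
  unfold slabM
  rw [Measure.volume_eq_prod, ← Measure.prod_restrict, Measure.restrict_univ]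

lemma slab_integrable {S : ℝ} {h : SpT n → ℝ} (hc : Continuous h)
    {K : Set (EuclideanSpace ℝ (Fin n))} (hK : IsCompact K) (h0 : ∀ z, z.1 ∉ K → h z = 0) :
    Integrable h (slabM n S) := by
  rw [slabM_eq]
  have h1 : IntegrableOn h (K ×ˢ Set.Icc (-S) (0:ℝ)) volume :=
    hc.continuousOn.integrableOn_compact (hK.prod isCompact_Icc)
  refine IntegrableOn.of_forall_sdiff_eq_zero h1 (MeasurableSet.univ.prod measurableSet_Icc) ?_
  rintro ⟨x, t⟩ ⟨h2, h3⟩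
  apply h0
  intro hx
  exact h3 ⟨hx, h2.2⟩

lemma Dv_supp {V : SpT n → ℝ} {K : Set (EuclideanSpace ℝ (Fin n))} (hK : IsClosed K)
    (h0 : ∀ z, z.1 ∉ K → V z = 0) (v : SpT n) : ∀ z, z.1 ∉ K → Dv v V z = 0 := by
  intro z hz
  have ho : IsOpen {z : SpT n | z.1 ∉ K} := hK.isOpen_compl.preimage continuous_fst
  have : V =ᶠ[nhds z] fun _ => 0 := by
    filter_upwards [ho.mem_nhds hz] with y hy using h0 y hy
  unfold Dv
  rw [this.fderiv_eq]; simp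

lemma slab_div {S : ℝ} {V : SpT n → ℝ} (hV : Sm V)
    {K : Set (EuclideanSpace ℝ (Fin n))} (hK : IsCompact K) (h0 : ∀ z, z.1 ∉ K → V z = 0)
    (i : Fin n) : ∫ z, Dv (ed i) V z ∂(slabM n S) = 0 := by
  have hD0 := Dv_supp hK.isClosed h0 (ed i)
  have hi := slab_integrable (S := S) (hV.dv (ed i)).continuous hK hD0
  unfold slabM at hi ⊢
  rw [integral_prod_symm _ hi]
  have : ∀ t : ℝ, ∫ x, Dv (ed i) V (x, t) = 0 := by
    intro t
    have hs : Sm (fun y : EuclideanSpace ℝ (Fin n) => V (y, t)) :=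
      hV.comp (contDiff_id.prodMk contDiff_const)
    have key := integral_mul_fderiv_eq_neg_fderiv_mul_of_integrable
      (μ := (volume : Measure (EuclideanSpace ℝ (Fin n))))
      (f := fun _ => (1:ℝ)) (g := fun y => V (y, t)) (v := EuclideanSpace.single i 1)
      (by simp) ?_ ?_ (by intros; fun_prop) (by intro x _; exact hs.diff x)
    · simp only [one_mul, slice_fderiv hV] at key
      simpa using key
    · simp only [one_mul, slice_fderiv hV]
      refine Continuous.integrable_of_hasCompactSupport ?_ ?_
      · exact (hV.dv (ed i)).continuous.comp (by fun_prop)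
      · exact HasCompactSupport.intro hK fun x hx => hD0 (x, t) hx
    · simp only [one_mul]
      refine Continuous.integrable_of_hasCompactSupport hs.continuous ?_
      exact HasCompactSupport.intro hK fun x hx => h0 (x, t) hx
  simp [this]

lemma slab_time {S : ℝ} (hS : 0 ≤ S) {V : SpT n → ℝ} (hV : Sm V)
    {K : Set (EuclideanSpace ℝ (Fin n))} (hK : IsCompact K) (h0 : ∀ z, z.1 ∉ K → V z = 0)
    (h1 : ∀ x, V (x, -S) = 0) (h2 : ∀ x, 0 ≤ V (x, 0)) :
    0 ≤ ∫ z, Dv (td n) V z ∂(slabM n S) := by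
  have hD0 := Dv_supp hK.isClosed h0 (td n)
  have hi := slab_integrable (S := S) (hV.dv (td n)).continuous hK hD0
  unfold slabM at hi ⊢
  rw [integral_prod _ hi]
  refine integral_nonneg fun x => ?_
  have hd : ∀ t : ℝ, HasDerivAt (fun s : ℝ => V (x, s)) (Dv (td n) V (x, t)) t := by
    intro t
    have a1 : HasDerivAt (fun s : ℝ => (x, s)) (td n) t :=
      (hasDerivAt_const t x).prodMk (hasDerivAt_id t)
    exact HasFDerivAt.comp_hasDerivAt t ((hV.diff (x, t)).hasFDerivAt) a1
  have hc : Continuous fun t : ℝ => Dv (td n) V (x, t) :=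
    (hV.dv (td n)).continuous.comp (by fun_prop)
  have := intervalIntegral.integral_eq_sub_of_hasDerivAt (a := -S) (b := 0)
    (fun t _ => hd t) (hc.intervalIntegrable _ _)
  simp only [Pi.zero_apply]
  rw [integral_Icc_eq_integral_Ioc, ← intervalIntegral.integral_of_le (by linarith), this, h1]
  simpa using h2 x

end slab

/-! ### Cutoff functions -/

section cutoff
variable {n : ℕ}

lemma Dv_scale {g : EuclideanSpace ℝ (Fin n) → ℝ} (hg : Sm g) (p w : EuclideanSpace ℝ (Fin n))
    (s : ℝ) (z : SpT n) :
    Dv ((w, 0) : SpT n) (fun z : SpT n => g (s • (z.1 - p))) z = s * Dv w g (s • (z.1 - p)) := by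
  have h1 : HasFDerivAt (fun z : SpT n => s • (z.1 - p))
      (s • ContinuousLinearMap.fst ℝ (EuclideanSpace ℝ (Fin n)) ℝ) z :=
    (hasFDerivAt_fst.sub_const p).const_smul s
  have h2 := ((hg.diff (s • (z.1 - p))).hasFDerivAt).comp z h1
  have h3 : fderiv ℝ (fun z : SpT n => g (s • (z.1 - p))) z = _ := h2.fderiv
  unfold Dv
  rw [h3]
  simp

lemma cutoff_exists {a b : ℝ} (ha : 0 < a) (hab : a < b) :
    ∃ K : ℝ, 0 < K ∧ ∀ (p : EuclideanSpace ℝ (Fin n)) (r : ℝ), 0 < r →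
      ∃ H : SpT n → ℝ, Sm H ∧ (∀ z, 0 ≤ H z) ∧ (∀ z, H z ≤ 1) ∧
        (∀ z, z.1 ∈ Metric.ball p (a * r) → H z = 1) ∧
        (∀ z, z.1 ∉ Metric.ball p (b * r) → H z = 0) ∧
        (∀ z, ∑ i, (Dv (ed i) H z) ^ 2 ≤ K / r ^ 2) ∧
        (∀ z, |Lpl H z| ≤ K / r ^ 2) ∧ (∀ z, Dv (td n) H z = 0) := by
  let β : ContDiffBump (0 : EuclideanSpace ℝ (Fin n)) := ⟨a, b, ha, hab⟩
  have hβ : Sm (β : EuclideanSpace ℝ (Fin n) → ℝ) := β.contDiff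
  have hcs : HasCompactSupport (β : EuclideanSpace ℝ (Fin n) → ℝ) := β.hasCompactSupport
  have hb1 : ∀ i : Fin n, ∃ C, ∀ x, ‖Dv (EuclideanSpace.single i 1) β x‖ ≤ C := fun i =>
    (hcs.fderiv_apply ℝ _).exists_bound_of_continuous (hβ.dv _).continuous
  have hb2 : ∀ i : Fin n, ∃ C, ∀ x,
      ‖Dv (EuclideanSpace.single i 1) (Dv (EuclideanSpace.single i 1) β) x‖ ≤ C := fun i =>
    ((hcs.fderiv_apply ℝ _).fderiv_apply ℝ _).exists_bound_of_continuous
      ((hβ.dv _).dv _).continuous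
  choose C1 hC1 using hb1
  choose C2 hC2 using hb2
  have hC2n : ∀ i, 0 ≤ C2 i := fun i => (norm_nonneg _).trans (hC2 i 0)
  have hs1 : 0 ≤ ∑ i, C1 i ^ 2 := Finset.sum_nonneg fun i _ => sq_nonneg _
  have hs2 : 0 ≤ ∑ i, C2 i := Finset.sum_nonneg fun i _ => hC2n i
  refine ⟨∑ i, C1 i ^ 2 + ∑ i, C2 i + 1, by linarith, ?_⟩
  intro p r hr
  have hrr : 0 < r ^ 2 := by positivity
  have hD : ∀ i, Dv (ed i) (fun z : SpT n => β (r⁻¹ • (z.1 - p))) =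
      fun z => r⁻¹ * Dv (EuclideanSpace.single i 1) β (r⁻¹ • (z.1 - p)) := by
    intro i; funext z; exact Dv_scale hβ p _ _ z
  have hcomp : ∀ g : EuclideanSpace ℝ (Fin n) → ℝ, Sm g →
      Sm (fun z : SpT n => g (r⁻¹ • (z.1 - p))) := fun g hg =>
    hg.comp ((contDiff_fst.sub contDiff_const).const_smul r⁻¹)
  have hDD : ∀ i z, Dv (ed i) (Dv (ed i) (fun z : SpT n => β (r⁻¹ • (z.1 - p)))) z =
      r⁻¹ * (r⁻¹ * Dv (EuclideanSpace.single i 1) (Dv (EuclideanSpace.single i 1) β)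
        (r⁻¹ • (z.1 - p))) := by
    intro i z
    rw [hD, Dv_mul contDiff_const (hcomp _ (hβ.dv _)), Dv_scale (hβ.dv _)]
    simp [Dv]
  have hnorm : ∀ x, dist (r⁻¹ • (x - p)) 0 = dist x p / r := by
    intro x
    rw [dist_zero_right, norm_smul, norm_inv, Real.norm_of_nonneg hr.le, dist_eq_norm]
    field_simp
  refine ⟨fun z => β (r⁻¹ • (z.1 - p)), hcomp _ hβ, fun z => β.nonneg, fun z => β.le_one,
    ?_, ?_, ?_, ?_, ?_⟩
  · intro z hz
    apply β.one_of_mem_closedBall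
    rw [Metric.mem_closedBall, hnorm, div_le_iff₀ hr]
    exact (Metric.mem_ball.1 hz).le
  · intro z hz
    apply β.zero_of_le_dist
    rw [hnorm, le_div_iff₀ hr]
    exact not_lt.1 hz
  · intro z
    rw [le_div_iff₀ hrr, Finset.sum_mul]
    calc _ ≤ ∑ i, C1 i ^ 2 := ?_
      _ ≤ _ := by linarith
    refine Finset.sum_le_sum fun i _ => ?_
    rw [hD]
    have := hC1 i (r⁻¹ • (z.1 - p))
    have h2 := pow_le_pow_left₀ (norm_nonneg _) this 2
    rw [Real.norm_eq_abs, sq_abs] at h2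
    refine le_trans (le_of_eq ?_) h2
    field_simp
  · intro z
    rw [le_div_iff₀ hrr]
    calc _ ≤ (∑ i, C2 i / r ^ 2) * r ^ 2 := ?_
      _ = ∑ i, C2 i := by rw [← Finset.sum_div]; field_simp
      _ ≤ _ := by linarith
    refine mul_le_mul_of_nonneg_right ?_ hrr.le
    unfold Lpl
    refine (Finset.abs_sum_le_sum_abs _ _).trans (Finset.sum_le_sum fun i _ => ?_)
    rw [hDD, ← mul_assoc, abs_mul, le_div_iff₀ hrr]
    have := hC2 i (r⁻¹ • (z.1 - p))
    rw [Real.norm_eq_abs] at this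
    refine le_trans (le_of_eq ?_) this
    rw [abs_of_pos (by positivity)]
    field_simp
  · intro z
    have h1 : HasFDerivAt (fun z : SpT n => r⁻¹ • (z.1 - p))
        (r⁻¹ • ContinuousLinearMap.fst ℝ (EuclideanSpace ℝ (Fin n)) ℝ) z :=
      (hasFDerivAt_fst.sub_const p).const_smul r⁻¹
    have h2 := ((hβ.diff (r⁻¹ • (z.1 - p))).hasFDerivAt).comp z h1
    have h3 : fderiv ℝ (fun z : SpT n => β (r⁻¹ • (z.1 - p))) z = _ := h2.fderiv
    unfold Dv
    rw [h3]
    simp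

end cutoff

/-! ### Pointwise computations -/

lemma alg_ineq {h g w S q M L N : ℝ} (h0 : 0 ≤ h) (h1 : h ≤ 1) (hS : 0 ≤ S) (hN : 0 ≤ N)
    (hNM : N ≤ M) (hL : |L| ≤ M) (hq : q ^ 2 ≤ N * S) :
    -2 * (h ^ 4 * g ^ 2 + 8 * h ^ 3 * g * q + w * g * (4 * h ^ 3 * L + 12 * h ^ 2 * N))
      - 514 * M * (h ^ 2 * S + h ^ 2 * w * g + 2 * h * w * q)
      ≤ -(h ^ 4 * g ^ 2 + M * h ^ 2 * S) + 266248 * M ^ 2 * w ^ 2 := by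
  have hM : 0 ≤ M := hN.trans hNM
  have hq2 : q ^ 2 ≤ M * S := hq.trans (by gcongr)
  have hq3 : h ^ 2 * q ^ 2 ≤ h ^ 2 * (M * S) := by gcongr
  have e1 := sq_nonneg (1 / 2 * h ^ 2 * g + 16 * h * q)
  have e2 := sq_nonneg (1 / 2 * h ^ 2 * g + w * (8 * h * L + 24 * N))
  have e3 := sq_nonneg (1 / 2 * h ^ 2 * g + 514 * M * w)
  have hY : (8 * h * L + 24 * N) ^ 2 ≤ (32 * M) ^ 2 := by
    apply sq_le_sq'
    · have := (abs_le.1 hL).1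
      nlinarith
    · have := (abs_le.1 hL).2
      nlinarith
  have hY2 : w ^ 2 * (8 * h * L + 24 * N) ^ 2 ≤ w ^ 2 * (32 * M) ^ 2 := by gcongr
  have e4 : -(2 * h * w * q) ≤ h ^ 2 * S / 2 + 2 * M * w ^ 2 := by
    have hb : 0 ≤ h ^ 2 * S / 2 + 2 * M * w ^ 2 := by positivity
    refine (neg_le_abs _).trans (abs_le_of_sq_le_sq ?_ hb)
    have h5 : (2 * h * w * q) ^ 2 ≤ 4 * w ^ 2 * (h ^ 2 * (M * S)) := by nlinarith [sq_nonneg w]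
    nlinarith [sq_nonneg (h ^ 2 * S / 2 - 2 * M * w ^ 2)]
  have e5 : 514 * M * -(2 * h * w * q) ≤ 514 * M * (h ^ 2 * S / 2 + 2 * M * w ^ 2) := by gcongr
  have e6 := mul_nonneg (sq_nonneg (h ^ 2)) (sq_nonneg g)
  nlinarith

section ptwise
variable {n : ℕ}

lemma sum_identity (h w g k : ℝ) (hi hii wi wii gii : Fin n → ℝ) :
    ∑ i, (2 * (h ^ 4 * w * gii i - (12 * h ^ 2 * hi i ^ 2 * w + 4 * h ^ 3 * hii i * w
        + 8 * h ^ 3 * hi i * wi i + h ^ 4 * wii i) * g)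
        - k * (h ^ 2 * wi i ^ 2 + h ^ 2 * w * wii i + 2 * h * hi i * w * wi i)) =
    2 * (h ^ 4 * w * (∑ i, gii i) - (12 * h ^ 2 * (∑ i, hi i ^ 2) * w + 4 * h ^ 3 * (∑ i, hii i) * w
        + 8 * h ^ 3 * (∑ i, hi i * wi i) + h ^ 4 * (∑ i, wii i)) * g)
        - k * (h ^ 2 * (∑ i, wi i ^ 2) + h ^ 2 * w * (∑ i, wii i)
          + 2 * h * w * (∑ i, hi i * wi i)) := by
  simp only [Finset.mul_sum, Finset.sum_mul, ← Finset.sum_add_distrib, ← Finset.sum_sub_distrib]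
  refine Finset.sum_congr rfl fun i _ => ?_
  ring

/-- The flux field. -/
def flux (S k : ℝ) (H w : SpT n → ℝ) (i : Fin n) : SpT n → ℝ := fun z =>
  (z.2 + S) * (2 * (H z ^ 4 * w z * Dv (ed i) (Lpl w) z
      - Dv (ed i) (fun z => H z ^ 4 * w z) z * Lpl w z)
    - k * (H z ^ 2 * w z * Dv (ed i) w z))

lemma tau_sm (S : ℝ) : Sm (fun z : SpT n => z.2 + S) := contDiff_snd.add contDiff_const

lemma flux_sm {S k : ℝ} {H w : SpT n → ℝ} (hH : Sm H) (hw : Sm w) (i : Fin n) :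
    Sm (flux S k H w i) := by
  have h1 : Sm (fun z => H z ^ 4 * w z) := (hH.pow 4).mul hw
  exact (tau_sm S).mul ((contDiff_const.mul ((h1.mul (hw.lp.dv _)).sub ((h1.dv _).mul hw.lp))).sub
    (contDiff_const.mul (((hH.pow 2).mul hw).mul (hw.dv _))))

lemma Dv_tau (S : ℝ) (v : SpT n) (z : SpT n) : Dv v (fun z : SpT n => z.2 + S) z = v.2 := by
  unfold Dv
  rw [(hasFDerivAt_snd.add_const S).fderiv]; simp

lemma Dv_const_mul {f : SpT n → ℝ} (hf : Sm f) (c : ℝ) (v z : SpT n) :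
    Dv v (fun y => c * f y) z = c * Dv v f z := by
  rw [Dv_mul contDiff_const hf]; simp [Dv]

lemma Dv_flux {S k : ℝ} {H w : SpT n → ℝ} (hH : Sm H) (hw : Sm w) (i : Fin n) (z : SpT n) :
    Dv (ed i) (flux S k H w i) z = (z.2 + S) *
      (2 * (H z ^ 4 * w z * Dv (ed i) (Dv (ed i) (Lpl w)) z -
        (12 * H z ^ 2 * Dv (ed i) H z ^ 2 * w z + 4 * H z ^ 3 * Dv (ed i) (Dv (ed i) H) z * w z
        + 8 * H z ^ 3 * Dv (ed i) H z * Dv (ed i) w z + H z ^ 4 * Dv (ed i) (Dv (ed i) w) z)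
          * Lpl w z)
        - k * (H z ^ 2 * Dv (ed i) w z ^ 2 + H z ^ 2 * w z * Dv (ed i) (Dv (ed i) w) z
          + 2 * H z * Dv (ed i) H z * w z * Dv (ed i) w z)) := by
  have h1 : Sm (fun z => H z ^ 4 * w z) := (hH.pow 4).mul hw
  have h2 : Dv (ed i) (fun z => H z ^ 4 * w z) =
      fun z => H z ^ 4 * Dv (ed i) w z + 4 * (H z ^ 3 * Dv (ed i) H z * w z) := by
    funext y
    rw [Dv_mul (hH.pow 4) hw, Dv_pow hH]
    push_cast; ring
  have a1 : Sm (fun z => H z ^ 4 * w z * Dv (ed i) (Lpl w) z) := h1.mul (hw.lp.dv _)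
  have a2 : Sm (fun z => Dv (ed i) (fun z => H z ^ 4 * w z) z * Lpl w z) := (h1.dv _).mul hw.lp
  have a3 : Sm (fun z => H z ^ 2 * w z * Dv (ed i) w z) := ((hH.pow 2).mul hw).mul (hw.dv _)
  have a3' : Sm (fun z => H z ^ 2 * w z) := ((hH.pow 2).mul hw)
  have a4 : Sm (fun z => H z ^ 3 * Dv (ed i) H z * w z) := ((hH.pow 3).mul (hH.dv _)).mul hw
  have a5 : Sm (fun z => H z ^ 3 * Dv (ed i) H z) := ((hH.pow 3).mul (hH.dv _))
  have a6 : Sm (fun z => H z ^ 4 * Dv (ed i) w z) := (hH.pow 4).mul (hw.dv _)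
  unfold flux
  rw [Dv_mul (tau_sm S) ((contDiff_const.mul (a1.sub a2)).sub (contDiff_const.mul a3)), Dv_tau,
    Dv_sub (contDiff_const.mul (a1.sub a2)) (contDiff_const.mul a3),
    Dv_const_mul (a1.sub a2), Dv_const_mul a3, Dv_sub a1 a2, Dv_mul h1 (hw.lp.dv _),
    Dv_mul (h1.dv _) hw.lp, Dv_mul a3' (hw.dv _), Dv_mul (hH.pow 2) hw, Dv_pow hH, h2,
    Dv_add a6 (contDiff_const.mul a4), Dv_const_mul a4, Dv_mul a5 hw, Dv_mul (hH.pow 3) (hH.dv _),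
    Dv_mul (hH.pow 4) (hw.dv _), Dv_pow hH, Dv_pow hH]
  push_cast
  ring

lemma Dv_energy {S : ℝ} {H w : SpT n → ℝ} (hH : Sm H) (hw : Sm w) (hHt : ∀ z, Dv (td n) H z = 0)
    (z : SpT n) :
    Dv (td n) (fun z => (z.2 + S) * (H z ^ 4 * w z ^ 2)) z =
      H z ^ 4 * w z ^ 2 + (z.2 + S) * (2 * H z ^ 4 * w z * Dv (td n) w z) := by
  rw [Dv_mul (tau_sm S) ((hH.pow 4).mul (hw.pow 2)), Dv_tau, Dv_mul (hH.pow 4) (hw.pow 2),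
    Dv_pow hH, Dv_pow hw, hHt]
  push_cast
  ring

lemma ptwise_ineq {S M : ℝ} {H w : SpT n → ℝ} (hH : Sm H) (hw : Sm w)
    (hHt : ∀ z, Dv (td n) H z = 0) {z : SpT n} (h0 : 0 ≤ H z) (h1 : H z ≤ 1)
    (hN : ∑ i, (Dv (ed i) H z) ^ 2 ≤ M) (hL : |Lpl H z| ≤ M) (ht : z.2 ∈ Set.Icc (-S) (0 : ℝ))
    (hb : Dv (td n) w z + Lpl (Lpl w) z = 0) :
    Dv (td n) (fun z => (z.2 + S) * (H z ^ 4 * w z ^ 2)) z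
      + ∑ i, Dv (ed i) (flux S (514 * M) H w i) z
      + (z.2 + S) * (H z ^ 4 * Lpl w z ^ 2 + M * H z ^ 2 * ∑ i, (Dv (ed i) w z) ^ 2)
      ≤ (1 + 266248 * M ^ 2 * S) * w z ^ 2 := by
  have hτ : 0 ≤ z.2 + S := by linarith [ht.1]
  have hτ2 : z.2 + S ≤ S := by linarith [ht.2]
  rw [Dv_energy hH hw hHt]
  simp only [Dv_flux hH hw]
  rw [← Finset.mul_sum, sum_identity]
  have hq : (∑ i, Dv (ed i) H z * Dv (ed i) w z) ^ 2 ≤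
      (∑ i, (Dv (ed i) H z) ^ 2) * ∑ i, (Dv (ed i) w z) ^ 2 :=
    Finset.sum_mul_sq_le_sq_mul_sq _ _ _
  have hwt : Dv (td n) w z = - Lpl (Lpl w) z := by linarith
  rw [hwt]
  have r1 : ∑ i, Dv (ed i) (Dv (ed i) (Lpl w)) z = Lpl (Lpl w) z := rfl
  have r2 : ∑ i, Dv (ed i) (Dv (ed i) H) z = Lpl H z := rfl
  have r3 : ∑ i, Dv (ed i) (Dv (ed i) w) z = Lpl w z := rfl
  rw [r1, r2, r3]
  have key := alg_ineq (w := w z) (g := Lpl w z) h0 h1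
    (Finset.sum_nonneg fun i _ => sq_nonneg (Dv (ed i) w z))
    (Finset.sum_nonneg fun i _ => sq_nonneg (Dv (ed i) H z)) hN hL hq
  have k2 := mul_le_mul_of_nonneg_left key hτ
  have k3 : H z ^ 4 * w z ^ 2 ≤ 1 * w z ^ 2 := by
    gcongr; exact pow_le_one₀ h0 h1
  have k4 : (z.2 + S) * (266248 * M ^ 2 * w z ^ 2) ≤ S * (266248 * M ^ 2 * w z ^ 2) := by
    gcongr
  linarith

end ptwise

/-! ### The Caccioppoli inequality -/

section cacc
variable {n : ℕ}

lemma heatBall_integrable {h : SpT n → ℝ} (hc : Continuous h) (p : EuclideanSpace ℝ (Fin n))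
    (r : ℝ) : IntegrableOn h (heatBall n p r) volume := by
  have h1 : IntegrableOn h (Metric.closedBall p r ×ˢ Set.Icc (-(r ^ 4)) (0:ℝ)) volume :=
    hc.continuousOn.integrableOn_compact ((isCompact_closedBall p r).prod isCompact_Icc)
  exact h1.mono_set (Set.prod_mono Metric.ball_subset_closedBall subset_rfl)

lemma heatBall_meas (p : EuclideanSpace ℝ (Fin n)) (r : ℝ) : MeasurableSet (heatBall n p r) :=
  Metric.isOpen_ball.measurableSet.prod measurableSet_Icc

lemma heatBall_mono (p : EuclideanSpace ℝ (Fin n)) {r s : ℝ} (hr : 0 ≤ r) (h : r ≤ s) :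
    heatBall n p r ⊆ heatBall n p s := by
  have : r ^ 4 ≤ s ^ 4 := pow_le_pow_left₀ hr h 4
  exact Set.prod_mono (Metric.ball_subset_ball h) (Set.Icc_subset_Icc_left (by linarith))

lemma slab_indicator (f : SpT n → ℝ) (p : EuclideanSpace ℝ (Fin n)) {r S : ℝ}
    (hS : r ^ 4 ≤ S) :
    ∫ z, (heatBall n p r).indicator f z ∂(slabM n S) = ∫ z in heatBall n p r, f z := by
  rw [integral_indicator (heatBall_meas p r), slabM_eq, Measure.restrict_restrict
    (heatBall_meas p r), Set.inter_eq_left.2]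
  exact Set.prod_mono (Set.subset_univ _) (Set.Icc_subset_Icc_left (by linarith))

lemma slab_indicator_integrable {f : SpT n → ℝ} (hf : Continuous f)
    (p : EuclideanSpace ℝ (Fin n)) (r S : ℝ) :
    Integrable ((heatBall n p r).indicator f) (slabM n S) := by
  rw [integrable_indicator_iff (heatBall_meas p r), slabM_eq]
  exact Integrable.mono_measure (heatBall_integrable hf p r)
    (Measure.restrict_mono_measure Measure.restrict_le_self _)

lemma cacc_core {p : EuclideanSpace ℝ (Fin n)} {ρ R M : ℝ} (hρ : 0 < ρ) (hρR : ρ < R)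
    (hM : 0 ≤ M) {H w : SpT n → ℝ} (hH : Sm H) (h0 : ∀ z, 0 ≤ H z) (h1 : ∀ z, H z ≤ 1)
    (hin : ∀ z, z.1 ∈ Metric.ball p ρ → H z = 1)
    (hout : ∀ z, z.1 ∉ Metric.ball p R → H z = 0)
    (hN : ∀ z, ∑ i, (Dv (ed i) H z) ^ 2 ≤ M) (hL : ∀ z, |Lpl H z| ≤ M)
    (hHt : ∀ z, Dv (td n) H z = 0) (hw : Sm w) (hb : Bic (R ^ 4) w) :
    (R ^ 4 - ρ ^ 4) * ((∫ z in heatBall n p ρ, Lpl w z ^ 2)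
      + M * ∫ z in heatBall n p ρ, ∑ i, (Dv (ed i) w z) ^ 2) ≤
    (1 + 266248 * M ^ 2 * R ^ 4) * ∫ z in heatBall n p R, w z ^ 2 := by
  have hRρ : ρ ^ 4 < R ^ 4 := pow_lt_pow_left₀ hρR hρ.le (by norm_num)
  have hR0 : 0 < R ^ 4 := by have := hρ.trans hρR; positivity
  set S := R ^ 4 with hSdef
  have hK : IsCompact (Metric.closedBall p R) := isCompact_closedBall p R
  have hH0 : ∀ z : SpT n, z.1 ∉ Metric.closedBall p R → H z = 0 := fun z hz =>
    hout z fun h => hz (Metric.ball_subset_closedBall h)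
  -- the functions
  let V : SpT n → ℝ := fun z => (z.2 + S) * (H z ^ 4 * w z ^ 2)
  have hV : Sm V := (tau_sm S).mul ((hH.pow 4).mul (hw.pow 2))
  have hV0 : ∀ z : SpT n, z.1 ∉ Metric.closedBall p R → V z = 0 := fun z hz => by
    simp [V, hH0 z hz]
  have hF : ∀ i, Sm (flux S (514 * M) H w i) := fun i => flux_sm hH hw i
  have hΦ0 : ∀ z : SpT n, z.1 ∉ Metric.closedBall p R → (fun z => H z ^ 4 * w z) z = 0 :=
    fun z hz => by simp [hH0 z hz]
  have hF0 : ∀ i, ∀ z : SpT n, z.1 ∉ Metric.closedBall p R → flux S (514 * M) H w i z = 0 :=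
    fun i z hz => by
      unfold flux
      rw [Dv_supp hK.isClosed hΦ0 (ed i) z hz]
      simp [hH0 z hz]
  let G : SpT n → ℝ := fun z =>
    (z.2 + S) * (H z ^ 4 * Lpl w z ^ 2 + M * H z ^ 2 * ∑ i, (Dv (ed i) w z) ^ 2)
  have hGrad : Sm (fun z => ∑ i, (Dv (ed i) w z) ^ 2) :=
    ContDiff.sum fun i _ => (hw.dv (ed i)).pow 2
  have hG : Sm G := (tau_sm S).mul (((hH.pow 4).mul (hw.lp.pow 2)).add
    ((contDiff_const.mul (hH.pow 2)).mul hGrad))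
  have hG0 : ∀ z : SpT n, z.1 ∉ Metric.closedBall p R → G z = 0 := fun z hz => by
    simp [G, hH0 z hz]
  let B : SpT n → ℝ := fun z => (1 + 266248 * M ^ 2 * S) * w z ^ 2
  have hB : Continuous B := continuous_const.mul (hw.continuous.pow 2)
  let Q : SpT n → ℝ := fun z => (S - ρ ^ 4) * (Lpl w z ^ 2 + M * ∑ i, (Dv (ed i) w z) ^ 2)
  have hQ : Continuous Q := continuous_const.mul ((hw.lp.continuous.pow 2).add
    (continuous_const.mul hGrad.continuous))
  -- integrability
  have iV := slab_integrable (S := S) (hV.dv (td n)).continuous hK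
    (Dv_supp hK.isClosed hV0 (td n))
  have iF : ∀ i, Integrable (Dv (ed i) (flux S (514 * M) H w i)) (slabM n S) := fun i =>
    slab_integrable (S := S) ((hF i).dv (ed i)).continuous hK (Dv_supp hK.isClosed (hF0 i) (ed i))
  have iG := slab_integrable (S := S) hG.continuous hK hG0
  have iB := slab_indicator_integrable hB p R S
  have iQ := slab_indicator_integrable hQ p ρ S
  have iFs : Integrable (fun z => ∑ i, Dv (ed i) (flux S (514 * M) H w i) z) (slabM n S) :=
    integrable_finsetSum _ fun i _ => iF i
  have hae : ∀ᵐ z ∂(slabM n S), z.2 ∈ Set.Icc (-S) (0:ℝ) := by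
    rw [slabM_eq]
    filter_upwards [ae_restrict_mem (MeasurableSet.univ.prod measurableSet_Icc)] with z hz
    exact hz.2
  have step1 : ∫ z, (heatBall n p ρ).indicator Q z ∂(slabM n S) ≤ ∫ z, G z ∂(slabM n S) := by
    refine integral_mono_ae iQ iG ?_
    filter_upwards [hae] with z hz
    have hgn : 0 ≤ ∑ i, (Dv (ed i) w z) ^ 2 := Finset.sum_nonneg fun i _ => sq_nonneg _
    have hτ : 0 ≤ z.2 + S := by linarith [hz.1]
    by_cases hzb : z ∈ heatBall n p ρ
    · rw [Set.indicator_of_mem hzb]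
      have hz1 : H z = 1 := hin z hzb.1
      have hz2 : S - ρ ^ 4 ≤ z.2 + S := by linarith [hzb.2.1]
      simp only [Q, G, hz1]
      rw [one_pow, one_pow, one_mul, mul_one]
      gcongr
    · rw [Set.indicator_of_notMem hzb]
      simp only [G]
      have := h0 z
      positivity
  have step2 : ∫ z, (Dv (td n) V z + ∑ i, Dv (ed i) (flux S (514 * M) H w i) z + G z) ∂(slabM n S)
      ≤ ∫ z, (heatBall n p R).indicator B z ∂(slabM n S) := by
    refine integral_mono_ae ((iV.add iFs).add iG) iB ?_
    filter_upwards [hae] with z hz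
    by_cases hzb : z.1 ∈ Metric.ball p R
    · have hm : z ∈ heatBall n p R := ⟨hzb, hz⟩
      rw [Set.indicator_of_mem hm]
      exact ptwise_ineq hH hw hHt (h0 z) (h1 z) (hN z) (hL z) hz (hb z.1 z.2 hz)
    · have hm : z ∉ heatBall n p R := fun h => hzb h.1
      rw [Set.indicator_of_notMem hm]
      have hz0 := hout z hzb
      simp only [V, G, Dv_energy hH hw hHt, Dv_flux hH hw, hz0]
      simp
  have iVF : Integrable (fun z => Dv (td n) V z + ∑ i, Dv (ed i) (flux S (514 * M) H w i) z)
      (slabM n S) := iV.add iFs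
  rw [integral_add iVF iG, integral_add iV iFs, integral_finsetSum _ fun i _ => iF i,
    Finset.sum_eq_zero (fun i _ => slab_div (hF i) hK (hF0 i) i)] at step2
  have step3 : 0 ≤ ∫ z, Dv (td n) V z ∂(slabM n S) :=
    slab_time hR0.le hV hK hV0 (fun x => by simp [V])
      (fun x => by
        have := h0 (x, 0)
        simp only [V]; positivity)
  rw [slab_indicator _ _ hRρ.le] at step1
  rw [slab_indicator _ _ hSdef.ge] at step2
  have e1 : ∫ z in heatBall n p ρ, Q z = (S - ρ ^ 4) * ((∫ z in heatBall n p ρ, Lpl w z ^ 2)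
      + M * ∫ z in heatBall n p ρ, ∑ i, (Dv (ed i) w z) ^ 2) := by
    simp only [Q]
    rw [integral_const_mul, integral_add, integral_const_mul]
    · exact heatBall_integrable (hw.lp.continuous.pow 2) p ρ
    · exact (heatBall_integrable hGrad.continuous p ρ).const_mul M
  have e2 : ∫ z in heatBall n p R, B z = (1 + 266248 * M ^ 2 * S) *
      ∫ z in heatBall n p R, w z ^ 2 := integral_const_mul _ _
  rw [← e1, ← e2]
  linarith

lemma cacc {a b : ℝ} (ha : 0 < a) (hab : a < b) :
    ∃ C : ℝ, 0 < C ∧ ∀ (p : EuclideanSpace ℝ (Fin n)) (r : ℝ), 0 < r → ∀ w : SpT n → ℝ, Sm w →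
      Bic ((b * r) ^ 4) w →
      r ^ 4 * (∫ z in heatBall n p (a * r), Lpl w z ^ 2) ≤
        C * (∫ z in heatBall n p (b * r), w z ^ 2) ∧
      r ^ 2 * (∫ z in heatBall n p (a * r), ∑ i, (Dv (ed i) w z) ^ 2) ≤
        C * (∫ z in heatBall n p (b * r), w z ^ 2) := by
  obtain ⟨K, hK, hcut⟩ := cutoff_exists (n := n) ha hab
  have hk : 0 < b ^ 4 - a ^ 4 := sub_pos.2 (pow_lt_pow_left₀ hab ha.le (by norm_num))
  have hbpos : 0 < b := ha.trans hab
  set A := (1 + 266248 * K ^ 2 * b ^ 4) / (b ^ 4 - a ^ 4) with hA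
  have hA0 : 0 < A := by positivity
  refine ⟨A + A / K, by positivity, ?_⟩
  intro p r hr w hw hb
  obtain ⟨H, hH, h0, h1, hin, hout, hN, hL, hHt⟩ := hcut p r hr
  have key := cacc_core (p := p) (mul_pos ha hr) (mul_lt_mul_of_pos_right hab hr)
    (M := K / r ^ 2) (by positivity) hH h0 h1 hin hout hN hL hHt hw hb
  have n1 : 0 ≤ ∫ z in heatBall n p (a * r), Lpl w z ^ 2 :=
    integral_nonneg fun z => sq_nonneg _
  have n2 : 0 ≤ ∫ z in heatBall n p (a * r), ∑ i, (Dv (ed i) w z) ^ 2 :=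
    integral_nonneg fun z => Finset.sum_nonneg fun i _ => sq_nonneg _
  have n3 : 0 ≤ ∫ z in heatBall n p (b * r), w z ^ 2 :=
    integral_nonneg fun z => sq_nonneg _
  generalize (∫ z in heatBall n p (a * r), Lpl w z ^ 2) = X at *
  generalize (∫ z in heatBall n p (a * r), ∑ i, (Dv (ed i) w z) ^ 2) = Y at *
  generalize (∫ z in heatBall n p (b * r), w z ^ 2) = Z at *
  have e1 : ((b * r) ^ 4 - (a * r) ^ 4) * (X + K / r ^ 2 * Y) =
      (b ^ 4 - a ^ 4) * (r ^ 4 * X + K * (r ^ 2 * Y)) := by field_simp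
  have e2 : (1 + 266248 * (K / r ^ 2) ^ 2 * (b * r) ^ 4) = 1 + 266248 * K ^ 2 * b ^ 4 := by
    field_simp
  rw [e1, e2] at key
  have k2 : r ^ 4 * X + K * (r ^ 2 * Y) ≤ A * Z := by
    rw [hA, div_mul_eq_mul_div, le_div_iff₀ hk]
    linarith
  have p1 : 0 ≤ r ^ 4 * X := by positivity
  have p2 : 0 ≤ K * (r ^ 2 * Y) := by positivity
  have p3 : 0 ≤ A * Z := by positivity
  have p4 : 0 ≤ A / K * Z := by positivity
  rw [add_mul]
  refine ⟨by linarith, ?_⟩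
  have : r ^ 2 * Y ≤ A / K * Z := by
    rw [div_mul_eq_mul_div, le_div_iff₀ hK]; linarith
  linarith

end cacc

/-- **Reverse Poincaré inequality for bicaloric functions** (Lemma 2.1, Euclidean case). -/
theorem reverse_poincare_bicaloric (n : ℕ) (hn : 1 ≤ n) (ε : ℝ) (hε : ε ∈ Set.Ioo (0 : ℝ) 1) :
    ∃ c : ℝ, 0 < c ∧
      ∀ (p : EuclideanSpace ℝ (Fin n)) (r : ℝ), 0 < r →
      ∀ u : EuclideanSpace ℝ (Fin n) × ℝ → ℝ, ContDiff ℝ (⊤ : ℕ∞) u → BicaloricOn n u r →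
      r ^ 4 * ((∫ z in heatBall n p (ε * r), shessNormSq n u z) +
          r ^ 2 * ∫ z in heatBall n p (ε * r), ‖sgrad n (slap n u) z‖ ^ 2) +
        r ^ 8 * ((∫ z in heatBall n p (ε * r), (tderiv n u z) ^ 2) +
          r ^ 2 * ∫ z in heatBall n p (ε * r), ‖sgrad n (tderiv n u) z‖ ^ 2) ≤
      c * ((∫ z in heatBall n p r, (u z) ^ 2) +
          r ^ 2 * ∫ z in heatBall n p r, ‖sgrad n u z‖ ^ 2) := by
  obtain ⟨hε0, hε1⟩ := hε
  set a1 : ℝ := (2 * ε + 1) / 3 with ha1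
  set a2 : ℝ := (ε + 2) / 3 with ha2
  have l1 : ε < a1 := by rw [ha1]; linarith
  have l2 : a1 < a2 := by rw [ha1, ha2]; linarith
  have l3 : a2 < 1 := by rw [ha2]; linarith
  obtain ⟨C1, hC1, c1⟩ := cacc (n := n) hε0 hε1
  obtain ⟨C2, hC2, c2⟩ := cacc (n := n) hε0 l1
  obtain ⟨C3, hC3, c3⟩ := cacc (n := n) (hε0.trans l1) l2
  obtain ⟨C4, hC4, c4⟩ := cacc (n := n) (hε0.trans (l1.trans l2)) l3
  refine ⟨C1 + C2 * C4 + C3 * C4 + C2 * C3 * C4, by positivity, ?_⟩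
  intro p r hr u hu hbic
  have hu : Sm u := hu
  have hb : Bic (r ^ 4) u := by
    intro x t ht
    have := hbic x t ht
    rwa [tderiv_eq hu, slap_eq hu, slap_eq hu.lp] at this
  have hb' : ∀ b : ℝ, 0 < b → b ≤ 1 → ∀ w : SpT n → ℝ, Bic (r ^ 4) w → Bic ((b * r) ^ 4) w := by
    intro b hb0 hb1 w hw x t ht
    refine hw x t ⟨?_, ht.2⟩
    have : (b * r) ^ 4 ≤ r ^ 4 := by
      apply pow_le_pow_left₀ (by positivity)
      nlinarith
    linarith [ht.1]
  -- rewriting the integrands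
  have E1 : ∫ z in heatBall n p (ε * r), shessNormSq n u z =
      ∑ j, ∫ z in heatBall n p (ε * r), ∑ i, (Dv (ed i) (Dv (ed j) u) z) ^ 2 := by
    rw [← integral_finsetSum]
    · refine integral_congr_ae (Filter.Eventually.of_forall fun z => ?_)
      simp only [shess_eq hu]
      exact Finset.sum_comm
    · intro j _
      exact heatBall_integrable (continuous_finsetSum _ fun i _ =>
        (((hu.dv (ed j)).dv (ed i)).continuous.pow 2)) _ _
  have E2 : ∫ z in heatBall n p (ε * r), ‖sgrad n (slap n u) z‖ ^ 2 =
      ∫ z in heatBall n p (ε * r), ∑ i, (Dv (ed i) (Lpl u) z) ^ 2 := by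
    rw [slap_eq hu]
    simp only [sgrad_eq hu.lp]
  have hεt : ∀ z ∈ heatBall n p (ε * r), z.2 ∈ Set.Icc (-(r ^ 4)) (0:ℝ) := fun z hz =>
    (heatBall_mono p (by positivity) (by nlinarith) hz : z ∈ heatBall n p r).2
  have E3 : ∫ z in heatBall n p (ε * r), (tderiv n u z) ^ 2 =
      ∫ z in heatBall n p (ε * r), Lpl (Lpl u) z ^ 2 := by
    refine setIntegral_congr_fun (heatBall_meas _ _) fun z hz => ?_
    have := hb z.1 z.2 (hεt z hz)
    simp only [tderiv_eq hu]
    have h2 : Dv (td n) u z = - Lpl (Lpl u) z := by linarith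
    rw [h2]; ring
  have E4 : ∫ z in heatBall n p (ε * r), ‖sgrad n (tderiv n u) z‖ ^ 2 =
      ∫ z in heatBall n p (ε * r), ∑ i, (Dv (ed i) (Lpl (Lpl u)) z) ^ 2 := by
    refine setIntegral_congr_fun (heatBall_meas _ _) fun z hz => ?_
    simp only [tderiv_eq hu, sgrad_eq (hu.dv (td n))]
    refine Finset.sum_congr rfl fun i _ => ?_
    have h0 := Dv_slice_zero (f := fun z => Dv (td n) u z + Lpl (Lpl u) z)
      ((hu.dv _).add hu.lp.lp) (t := z.2) (fun x => hb x z.2 (hεt z hz)) i z.1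
    rw [Dv_add (hu.dv _) hu.lp.lp] at h0
    have h2 : Dv (ed i) (Dv (td n) u) z = - Dv (ed i) (Lpl (Lpl u)) z := by linarith
    rw [h2]; ring
  have E5 : ∫ z in heatBall n p r, ‖sgrad n u z‖ ^ 2 =
      ∑ j, ∫ z in heatBall n p r, (Dv (ed j) u z) ^ 2 := by
    simp only [sgrad_eq hu]
    exact integral_finsetSum _ fun j _ => heatBall_integrable ((hu.dv (ed j)).continuous.pow 2) _ _
  rw [E1, E2, E3, E4, E5]
  -- the estimates
  have b1 : ∀ j, r ^ 2 * (∫ z in heatBall n p (ε * r), ∑ i, (Dv (ed i) (Dv (ed j) u) z) ^ 2) ≤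
      C1 * ∫ z in heatBall n p r, (Dv (ed j) u z) ^ 2 := by
    intro j
    have := (c1 p r hr (Dv (ed j) u) (hu.dv _)
      (hb' 1 one_pos le_rfl _ (hb.dv hu j))).2
    rwa [one_mul] at this
  have B1 : r ^ 2 * (∑ j, ∫ z in heatBall n p (ε * r), ∑ i, (Dv (ed i) (Dv (ed j) u) z) ^ 2) ≤
      C1 * ∑ j, ∫ z in heatBall n p r, (Dv (ed j) u z) ^ 2 := by
    rw [Finset.mul_sum, Finset.mul_sum]
    exact Finset.sum_le_sum fun j _ => b1 j
  have hbL := hb.lp hu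
  have hbLL := hbL.lp hu.lp
  have B4 := (c4 p r hr u hu (hb' 1 one_pos le_rfl _ hb)).1
  rw [one_mul] at B4
  have B3 := (c3 p r hr (Lpl u) hu.lp (hb' a2 (by linarith) l3.le _ hbL)).1
  have B2 := (c2 p r hr (Lpl u) hu.lp (hb' a1 (by linarith) (by linarith) _ hbL)).2
  have B5 := (c2 p r hr (Lpl (Lpl u)) hu.lp.lp (hb' a1 (by linarith) (by linarith) _ hbLL)).2
  have M1 : ∫ z in heatBall n p (a1 * r), Lpl u z ^ 2 ≤ ∫ z in heatBall n p (a2 * r), Lpl u z ^ 2 :=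
    setIntegral_mono_set (heatBall_integrable (hu.lp.continuous.pow 2) _ _)
      (Filter.Eventually.of_forall fun z => sq_nonneg _)
      (Filter.Eventually.of_forall (heatBall_mono p (by nlinarith) (by nlinarith)))
  have M2 : ∫ z in heatBall n p (ε * r), Lpl (Lpl u) z ^ 2 ≤
      ∫ z in heatBall n p (a1 * r), Lpl (Lpl u) z ^ 2 :=
    setIntegral_mono_set (heatBall_integrable (hu.lp.lp.continuous.pow 2) _ _)
      (Filter.Eventually.of_forall fun z => sq_nonneg _)
      (Filter.Eventually.of_forall (heatBall_mono p (by positivity) (by nlinarith)))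
  have nF : 0 ≤ ∫ z in heatBall n p r, u z ^ 2 := integral_nonneg fun z => sq_nonneg _
  have nP : 0 ≤ ∑ j, ∫ z in heatBall n p r, (Dv (ed j) u z) ^ 2 :=
    Finset.sum_nonneg fun j _ => integral_nonneg fun z => sq_nonneg _
  generalize (∑ j, ∫ z in heatBall n p (ε * r), ∑ i, (Dv (ed i) (Dv (ed j) u) z) ^ 2) = X1 at *
  generalize (∫ z in heatBall n p (ε * r), ∑ i, (Dv (ed i) (Lpl u) z) ^ 2) = X2 at *
  generalize (∫ z in heatBall n p (ε * r), Lpl (Lpl u) z ^ 2) = X3 at *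
  generalize (∫ z in heatBall n p (ε * r), ∑ i, (Dv (ed i) (Lpl (Lpl u)) z) ^ 2) = X4 at *
  generalize (∫ z in heatBall n p r, u z ^ 2) = F at *
  generalize (∑ j, ∫ z in heatBall n p r, (Dv (ed j) u z) ^ 2) = P at *
  generalize (∫ z in heatBall n p (a1 * r), Lpl u z ^ 2) = Y1 at *
  generalize (∫ z in heatBall n p (a2 * r), Lpl u z ^ 2) = Y2 at *
  generalize (∫ z in heatBall n p (a1 * r), Lpl (Lpl u) z ^ 2) = Y3 at *
  have T1 : r ^ 4 * X1 ≤ C1 * (r ^ 2 * P) := by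
    calc r ^ 4 * X1 = r ^ 2 * (r ^ 2 * X1) := by ring
      _ ≤ r ^ 2 * (C1 * P) := by gcongr
      _ = _ := by ring
  have T2 : r ^ 6 * X2 ≤ C2 * C4 * F := by
    calc r ^ 6 * X2 = r ^ 4 * (r ^ 2 * X2) := by ring
      _ ≤ r ^ 4 * (C2 * Y2) :=
          mul_le_mul_of_nonneg_left (B2.trans (mul_le_mul_of_nonneg_left M1 hC2.le)) (by positivity)
      _ = C2 * (r ^ 4 * Y2) := by ring
      _ ≤ C2 * (C4 * F) := by gcongr
      _ = _ := by ring
  have T3' : r ^ 8 * Y3 ≤ C3 * C4 * F := by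
    calc r ^ 8 * Y3 = r ^ 4 * (r ^ 4 * Y3) := by ring
      _ ≤ r ^ 4 * (C3 * Y2) := by gcongr
      _ = C3 * (r ^ 4 * Y2) := by ring
      _ ≤ C3 * (C4 * F) := by gcongr
      _ = _ := by ring
  have T3 : r ^ 8 * X3 ≤ C3 * C4 * F := le_trans (by gcongr) T3'
  have T4 : r ^ 10 * X4 ≤ C2 * C3 * C4 * F := by
    calc r ^ 10 * X4 = r ^ 8 * (r ^ 2 * X4) := by ring
      _ ≤ r ^ 8 * (C2 * Y3) := by gcongr
      _ = C2 * (r ^ 8 * Y3) := by ring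
      _ ≤ C2 * (C3 * C4 * F) := by gcongr
      _ = _ := by ring
  have q1 : 0 ≤ (C2 * C4 + C3 * C4 + C2 * C3 * C4) * (r ^ 2 * P) := by positivity
  have q2 : 0 ≤ C1 * F := by positivity
  calc _ = r ^ 4 * X1 + r ^ 6 * X2 + r ^ 8 * X3 + r ^ 10 * X4 := by ring
    _ ≤ C1 * (r ^ 2 * P) + C2 * C4 * F + C3 * C4 * F + C2 * C3 * C4 * F := by linarith
    _ ≤ _ := by linarith
end
end

section
/- Hessian estimate for bicaloric functions (Lemma 2.2, Euclidean case): For every integer n ≥ 1 and every ε ∈ (0,1) there is a constant c = c(n,ε) > 0 with the following property. Let p ∈ ℝⁿ, r > 0, and let u : ℝⁿ × ℝ → ℝ be smooth and satisfy ∂_t u + ΔΔu = 0 on ℝⁿ × [−r⁴, 0]. Then r⁴·∫_{Q_{εr}(p)} |∇²u|² ≤ c·(∫_{Q_r(p)} u² + r²·∫_{Q_r(p)} |∇u|²). -/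
open Set Metric MeasureTheory

noncomputable section

section helpers

variable {E : Type*} [NormedAddCommGroup E] [NormedSpace ℝ E]

/-- directional derivative -/
def dd (v : E) (f : E → ℝ) : E → ℝ := fun x => fderiv ℝ f x v

lemma dd_smooth {v : E} {f : E → ℝ} (hf : ContDiff ℝ (⊤ : ℕ∞) f) :
    ContDiff ℝ (⊤ : ℕ∞) (dd v f) :=
  (hf.fderiv_right (by exact le_rfl)).clm_apply contDiff_const

lemma smooth_diff {f : E → ℝ} (hf : ContDiff ℝ (⊤ : ℕ∞) f) : Differentiable ℝ f :=
  hf.differentiable (by simp)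

lemma dd_mul (v : E) {f g : E → ℝ} (hf : ContDiff ℝ (⊤ : ℕ∞) f) (hg : ContDiff ℝ (⊤ : ℕ∞) g) :
    dd v (fun x => f x * g x) = fun x => f x * dd v g x + dd v f x * g x := by
  funext x
  simp only [dd]
  rw [fderiv_fun_mul (smooth_diff hf x) (smooth_diff hg x)]
  simp [mul_comm]

lemma dd_add (v : E) {f g : E → ℝ} (hf : ContDiff ℝ (⊤ : ℕ∞) f) (hg : ContDiff ℝ (⊤ : ℕ∞) g) :
    dd v (fun x => f x + g x) = fun x => dd v f x + dd v g x := by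
  funext x
  simp only [dd]
  rw [fderiv_fun_add (smooth_diff hf x) (smooth_diff hg x)]
  simp

lemma dd_sum {ι : Type*} [Fintype ι] (v : E) {f : ι → E → ℝ}
    (hf : ∀ i, ContDiff ℝ (⊤ : ℕ∞) (f i)) :
    dd v (fun x => ∑ i, f i x) = fun x => ∑ i, dd v (f i) x := by
  funext x
  simp only [dd]
  rw [fderiv_fun_sum (fun i _ => smooth_diff (hf i) x)]
  simp

lemma dd_comm (v w : E) {f : E → ℝ} (hf : ContDiff ℝ (⊤ : ℕ∞) f) :
    dd v (dd w f) = dd w (dd v f) := by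
  have hd : Differentiable ℝ (fderiv ℝ f) :=
    (hf.fderiv_right (m := (⊤ : ℕ∞)) (by exact le_rfl)).differentiable (by simp)
  have key : ∀ a b : E, ∀ x, dd a (dd b f) x = fderiv ℝ (fderiv ℝ f) x a b := by
    intro a b x
    have : HasFDerivAt (fun y => fderiv ℝ f y b)
        ((ContinuousLinearMap.apply ℝ ℝ b).comp (fderiv ℝ (fderiv ℝ f) x)) x :=
      (ContinuousLinearMap.apply ℝ ℝ b).hasFDerivAt.comp x (hd x).hasFDerivAt
    change fderiv ℝ (fun y => fderiv ℝ f y b) x a = _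
    rw [this.fderiv]
    simp
  funext x
  rw [key, key]
  have hs : IsSymmSndFDerivAt ℝ f x := (hf.contDiffAt).isSymmSndFDerivAt (by
    simp only [minSmoothness_of_isRCLikeNormedField]
    exact WithTop.coe_le_coe.2 (le_top : (2 : ℕ∞) ≤ ⊤))
  exact hs v w

lemma dd_compact {v : E} {f : E → ℝ} (hf : HasCompactSupport f) : HasCompactSupport (dd v f) :=
  hf.fderiv_apply ℝ v

lemma dd_scale (v p : E) (s : ℝ) {f : E → ℝ} (hf : ContDiff ℝ (⊤ : ℕ∞) f) :
    dd v (fun x => f (s • (x - p))) = fun x => s * dd v f (s • (x - p)) := by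
  funext x
  have h1 : HasFDerivAt (fun x : E => s • (x - p)) (s • ContinuousLinearMap.id ℝ E) x :=
    ((hasFDerivAt_id x).sub_const p).const_smul s
  have h2 := (smooth_diff hf (s • (x - p))).hasFDerivAt.comp x h1
  change fderiv ℝ (f ∘ fun x => s • (x - p)) x v = _
  rw [h2.fderiv]
  simp [dd]

lemma dd_const_mul (v : E) (c : ℝ) {f : E → ℝ} (hf : ContDiff ℝ (⊤ : ℕ∞) f) :
    dd v (fun x => c * f x) = fun x => c * dd v f x := by
  funext x
  simp only [dd]
  rw [fderiv_const_mul (smooth_diff hf x)]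
  simp

lemma dd_pow4 (v : E) {h : E → ℝ} (hh : ContDiff ℝ (⊤ : ℕ∞) h) :
    dd v (fun x => h x ^ 4) = fun x => 4 * (h x ^ 3 * dd v h x) := by
  funext x
  simp only [dd]
  rw [((smooth_diff hh x).hasFDerivAt.pow 4).fderiv]
  simp
  ring

lemma dd_pow3 (v : E) {h : E → ℝ} (hh : ContDiff ℝ (⊤ : ℕ∞) h) :
    dd v (fun x => h x ^ 3) = fun x => 3 * (h x ^ 2 * dd v h x) := by
  funext x
  simp only [dd]
  rw [((smooth_diff hh x).hasFDerivAt.pow 3).fderiv]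
  simp
  ring

lemma dd_dd_pow4 (v w : E) {h : E → ℝ} (hh : ContDiff ℝ (⊤ : ℕ∞) h) (x : E) :
    dd v (dd w (fun x => h x ^ 4)) x =
      h x ^ 2 * (12 * (dd v h x * dd w h x) + 4 * (h x * dd v (dd w h) x)) := by
  rw [dd_pow4 w hh, dd_const_mul _ _ ((hh.pow 3).mul (dd_smooth hh)),
    dd_mul v (hh.pow 3) (dd_smooth hh), dd_pow3 v hh]
  ring

lemma dd_dd_mul (v w : E) {f g : E → ℝ} (hf : ContDiff ℝ (⊤ : ℕ∞) f)
    (hg : ContDiff ℝ (⊤ : ℕ∞) g) (x : E) :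
    dd v (dd w (fun x => f x * g x)) x =
      f x * dd v (dd w g) x + dd v f x * dd w g x + dd w f x * dd v g x
        + dd v (dd w f) x * g x := by
  rw [dd_mul w hf hg, dd_add v (hf.mul (dd_smooth hg)) ((dd_smooth hf).mul hg),
    dd_mul v hf (dd_smooth hg), dd_mul v (dd_smooth hf) hg]
  ring

lemma dd_slice (v : E) {u : E × ℝ → ℝ} (hu : ContDiff ℝ (⊤ : ℕ∞) u) (t : ℝ) :
    dd v (fun y => u (y, t)) = fun x => dd ((v, 0) : E × ℝ) u (x, t) := by
  funext x
  have h1 : HasFDerivAt (fun y : E => (y, t)) (ContinuousLinearMap.inl ℝ E ℝ) x :=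
    hasFDerivAt_prodMk_left x t
  have h2 := (smooth_diff hu (x, t)).hasFDerivAt.comp x h1
  change fderiv ℝ (u ∘ fun y => (y, t)) x v = _
  rw [h2.fderiv]
  simp [dd]

lemma dd_dd_slice (v w : E) {u : E × ℝ → ℝ} (hu : ContDiff ℝ (⊤ : ℕ∞) u) (t : ℝ) :
    dd v (dd w (fun y => u (y, t))) =
      fun x => dd ((v, 0) : E × ℝ) (dd ((w, 0) : E × ℝ) u) (x, t) := by
  rw [dd_slice w hu t, dd_slice v (dd_smooth hu) t]

lemma smooth_slice {u : E × ℝ → ℝ} (hu : ContDiff ℝ (⊤ : ℕ∞) u) (t : ℝ) :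
    ContDiff ℝ (⊤ : ℕ∞) (fun y => u (y, t)) :=
  hu.comp (contDiff_id.prodMk contDiff_const)

variable [FiniteDimensional ℝ E] [MeasurableSpace E] [BorelSpace E]
  {μ : Measure E} [μ.IsAddHaarMeasure]

lemma dd_ibp (v : E) {f g : E → ℝ} (hf : ContDiff ℝ (⊤ : ℕ∞) f) (hg : ContDiff ℝ (⊤ : ℕ∞) g)
    (hc : HasCompactSupport f) :
    ∫ x, f x * dd v g x ∂μ = - ∫ x, dd v f x * g x ∂μ := by
  refine integral_mul_fderiv_eq_neg_fderiv_mul_of_integrable ?_ ?_ ?_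
    (fun x _ => smooth_diff hf x) (fun x _ => smooth_diff hg x)
  · exact ((dd_smooth (v := v) hf).continuous.mul hg.continuous).integrable_of_hasCompactSupport
      ((dd_compact (v := v) hc).mul_right)
  · exact (hf.continuous.mul (dd_smooth (v := v) hg).continuous).integrable_of_hasCompactSupport
      (hc.mul_right)
  · exact (hf.continuous.mul hg.continuous).integrable_of_hasCompactSupport
      (hc.mul_right)

lemma dd_ibp4 (v w : E) {f g : E → ℝ} (hf : ContDiff ℝ (⊤ : ℕ∞) f) (hg : ContDiff ℝ (⊤ : ℕ∞) g)
    (hc : HasCompactSupport f) :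
    ∫ x, f x * dd v (dd v (dd w (dd w g))) x ∂μ = ∫ x, dd w (dd v f) x * dd v (dd w g) x ∂μ := by
  rw [dd_ibp v hf (dd_smooth (dd_smooth (dd_smooth hg))) hc,
    dd_comm v w (dd_smooth hg),
    dd_ibp w (dd_smooth hf) (dd_smooth (dd_smooth hg)) (dd_compact hc), neg_neg]

end helpers

abbrev ee {n : ℕ} (i : Fin n) : EuclideanSpace ℝ (Fin n) := EuclideanSpace.single i 1

lemma lapE_eq (n : ℕ) (f : EuclideanSpace ℝ (Fin n) → ℝ) :
    lapE n f = fun x => ∑ i, dd (ee i) (dd (ee i) f) x := rfl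

lemma lapE_lapE (n : ℕ) {f : EuclideanSpace ℝ (Fin n) → ℝ} (hf : ContDiff ℝ (⊤ : ℕ∞) f) :
    lapE n (lapE n f) =
      fun x => ∑ i, ∑ j, dd (ee i) (dd (ee i) (dd (ee j) (dd (ee j) f))) x := by
  rw [lapE_eq n (lapE n f), lapE_eq n f]
  funext x
  refine Finset.sum_congr rfl fun i _ => ?_
  rw [dd_sum _ (fun j => dd_smooth (dd_smooth hf)),
    dd_sum _ (fun j => dd_smooth (dd_smooth (dd_smooth hf)))]

lemma ibp_bilap (n : ℕ) {f g : EuclideanSpace ℝ (Fin n) → ℝ}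
    (hf : ContDiff ℝ (⊤ : ℕ∞) f) (hg : ContDiff ℝ (⊤ : ℕ∞) g) (hc : HasCompactSupport f) :
    ∫ x, f x * lapE n (lapE n g) x =
      ∫ x, ∑ i, ∑ j, dd (ee j) (dd (ee i) f) x * dd (ee i) (dd (ee j) g) x := by
  rw [lapE_lapE n hg]
  simp only [Finset.mul_sum]
  have i1 : ∀ i j : Fin n, Integrable
      (fun x => f x * dd (ee i) (dd (ee i) (dd (ee j) (dd (ee j) g))) x) := fun i j =>
    (hf.continuous.mul (dd_smooth (dd_smooth (dd_smooth
      (dd_smooth hg)))).continuous).integrable_of_hasCompactSupport hc.mul_right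
  have i2 : ∀ i j : Fin n, Integrable
      (fun x => dd (ee j) (dd (ee i) f) x * dd (ee i) (dd (ee j) g) x) := fun i j =>
    ((dd_smooth (dd_smooth hf)).continuous.mul (dd_smooth
      (dd_smooth hg)).continuous).integrable_of_hasCompactSupport
        (dd_compact (dd_compact hc)).mul_right
  rw [integral_finsetSum _ (fun i _ => integrable_finsetSum _ (fun j _ => i1 i j)),
    integral_finsetSum _ (fun i _ => integrable_finsetSum _ (fun j _ => i2 i j))]
  refine Finset.sum_congr rfl fun i _ => ?_
  rw [integral_finsetSum _ (fun j _ => i1 i j), integral_finsetSum _ (fun j _ => i2 i j)]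
  exact Finset.sum_congr rfl fun j _ => dd_ibp4 _ _ hf hg hc

lemma norm_sgrad_sq (n : ℕ) (u : EuclideanSpace ℝ (Fin n) × ℝ → ℝ)
    (hu : ContDiff ℝ (⊤ : ℕ∞) u) (z : EuclideanSpace ℝ (Fin n) × ℝ) :
    ‖sgrad n u z‖ ^ 2 = ∑ i, (dd ((ee i, 0) : EuclideanSpace ℝ (Fin n) × ℝ) u z) ^ 2 := by
  rw [EuclideanSpace.norm_sq_eq]
  refine Finset.sum_congr rfl fun i _ => ?_
  have h1 : sgrad n u z i = inner ℝ (sgrad n u z) (ee i) := by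
    simp [ee, EuclideanSpace.inner_single_right]
  have h2 : inner ℝ (sgrad n u z) (ee i) = dd (ee i) (fun y => u (y, z.2)) z.1 := by
    simp only [sgrad, gradient, dd]
    exact InnerProductSpace.toDual_symm_apply
  rw [h1, h2, dd_slice _ hu, Real.norm_eq_abs, sq_abs]

lemma shess_eq_s1 (n : ℕ) (u : EuclideanSpace ℝ (Fin n) × ℝ → ℝ)
    (hu : ContDiff ℝ (⊤ : ℕ∞) u) (z : EuclideanSpace ℝ (Fin n) × ℝ) :
    shessNormSq n u z = ∑ i, ∑ j, (dd ((ee i, 0) : EuclideanSpace ℝ (Fin n) × ℝ)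
      (dd ((ee j, 0) : EuclideanSpace ℝ (Fin n) × ℝ) u) z) ^ 2 := by
  have : shessNormSq n u z =
      ∑ i, ∑ j, (dd (ee i) (dd (ee j) (fun y => u (y, z.2))) z.1) ^ 2 := rfl
  rw [this]
  simp only [dd_dd_slice _ _ hu]

lemma exists_cutoff (n : ℕ) (ε : ℝ) (hε : ε ∈ Set.Ioo (0 : ℝ) 1) :
    ∃ K : ℝ, 0 < K ∧ ∀ (p : EuclideanSpace ℝ (Fin n)) (r : ℝ), 0 < r →
      ∃ ψ : EuclideanSpace ℝ (Fin n) → ℝ, ContDiff ℝ (⊤ : ℕ∞) ψ ∧ HasCompactSupport ψ ∧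
        (∀ x, 0 ≤ ψ x) ∧ (∀ x, ψ x ≤ 1) ∧ (∀ x ∈ ball p (ε * r), ψ x = 1) ∧
        (∀ x, x ∉ ball p r → ψ x = 0) ∧
        (∀ i x, (dd (ee i) ψ x) ^ 2 ≤ K / r ^ 2 * ψ x) ∧
        (∀ i j x, (dd (ee i) (dd (ee j) ψ) x) ^ 2 ≤ K / r ^ 4 * ψ x) := by
  let f : ContDiffBump (0 : EuclideanSpace ℝ (Fin n)) := ⟨ε, 1, hε.1, hε.2⟩
  have hf : ContDiff ℝ (⊤ : ℕ∞) (f : EuclideanSpace ℝ (Fin n) → ℝ) := f.contDiff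
  have hfc : HasCompactSupport (f : EuclideanSpace ℝ (Fin n) → ℝ) := f.hasCompactSupport
  choose M1 hM1 using fun i : Fin n =>
    (dd_compact (v := ee i) hfc).exists_bound_of_continuous (dd_smooth hf).continuous
  choose M2 hM2 using fun i j : Fin n =>
    (dd_compact (v := ee i) (dd_compact (v := ee j) hfc)).exists_bound_of_continuous
      (dd_smooth (dd_smooth hf)).continuous
  obtain ⟨A, hA⟩ := Finite.exists_le M1
  obtain ⟨B, hB⟩ := Finite.exists_le (fun q : Fin n × Fin n => M2 q.1 q.2)
  obtain ⟨M, hM0, hMA, hMB⟩ : ∃ M : ℝ, 0 ≤ M ∧ A ≤ M ∧ B ≤ M :=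
    ⟨max 0 (max A B), by simp, by simp, by simp⟩
  refine ⟨(12 * M ^ 2 + 4 * M) ^ 2 + 16 * M ^ 2 + 1, by positivity, ?_⟩
  intro p r hr
  set h : EuclideanSpace ℝ (Fin n) → ℝ := fun x => f (r⁻¹ • (x - p)) with hh
  have hhs : ContDiff ℝ (⊤ : ℕ∞) h :=
    hf.comp ((contDiff_id.sub contDiff_const).const_smul r⁻¹)
  have hnorm : ∀ x, ‖r⁻¹ • (x - p)‖ = dist x p / r := by
    intro x
    rw [norm_smul, dist_eq_norm, norm_inv, Real.norm_eq_abs, abs_of_pos hr]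
    ring
  have hz : ∀ x, x ∉ ball p r → h x = 0 := by
    intro x hx
    apply f.zero_of_le_dist
    rw [dist_zero_right, hnorm, le_div_iff₀ hr]
    simpa [f] using hx
  have h0 : ∀ x, 0 ≤ h x := fun x => f.nonneg
  have h1 : ∀ x, h x ≤ 1 := fun x => f.le_one
  have b1 : ∀ i x, |dd (ee i) h x| ≤ M / r := by
    intro i x
    rw [hh, dd_scale _ _ _ hf]
    simp only [abs_mul, abs_inv, abs_of_pos hr]
    rw [div_eq_inv_mul]
    gcongr
    exact (hM1 i _).trans ((hA i).trans hMA)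
  have b2 : ∀ i j x, |dd (ee i) (dd (ee j) h) x| ≤ M / r ^ 2 := by
    intro i j x
    rw [hh, dd_scale _ _ _ hf, dd_const_mul, dd_scale _ _ _ (dd_smooth hf)]
    · simp only [abs_mul, abs_inv, abs_of_pos hr]
      rw [← mul_assoc, div_eq_inv_mul, sq, mul_inv]
      gcongr
      exact (hM2 i j _).trans ((hB (i, j)).trans hMB)
    · exact (dd_smooth hf).comp ((contDiff_id.sub contDiff_const).const_smul r⁻¹)
  refine ⟨fun x => h x ^ 4, hhs.pow 4, ?_, ?_, ?_, ?_, ?_, ?_, ?_⟩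
  · refine HasCompactSupport.intro (isCompact_closedBall p r) fun x hx => ?_
    rw [hz x (fun h => hx (ball_subset_closedBall h))]
    norm_num
  · intro x; have := h0 x; positivity
  · intro x; exact pow_le_one₀ (h0 x) (h1 x)
  · intro x hx
    have : h x = 1 := by
      apply f.one_of_mem_closedBall
      rw [mem_closedBall, dist_zero_right, hnorm, div_le_iff₀ hr]
      exact (mem_ball.1 hx).le
    simp [this]
  · intro x hx
    simp [hz x hx]
  · intro i x
    rw [dd_pow4 _ hhs]
    have e1 : (dd (ee i) h x) ^ 2 ≤ M ^ 2 / r ^ 2 := by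
      rw [← div_pow, ← sq_abs]
      exact pow_le_pow_left₀ (abs_nonneg _) (b1 i x) 2
    have e2 : h x ^ 6 ≤ h x ^ 4 := pow_le_pow_of_le_one (h0 x) (h1 x) (by norm_num)
    calc (4 * (h x ^ 3 * dd (ee i) h x)) ^ 2 = 16 * (h x ^ 6 * (dd (ee i) h x) ^ 2) := by ring
      _ ≤ 16 * (h x ^ 4 * (M ^ 2 / r ^ 2)) := by
          have := h0 x
          gcongr
      _ = (16 * M ^ 2) / r ^ 2 * h x ^ 4 := by ring
      _ ≤ _ := by
          have := h0 x
          gcongr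
          nlinarith [sq_nonneg (12 * M ^ 2 + 4 * M)]
  · intro i j x
    rw [dd_dd_pow4 _ _ hhs]
    have e1 : |12 * (dd (ee i) h x * dd (ee j) h x) + 4 * (h x * dd (ee i) (dd (ee j) h) x)|
        ≤ (12 * M ^ 2 + 4 * M) / r ^ 2 := by
      calc _ ≤ |12 * (dd (ee i) h x * dd (ee j) h x)|
              + |4 * (h x * dd (ee i) (dd (ee j) h) x)| := abs_add_le _ _
        _ = 12 * (|dd (ee i) h x| * |dd (ee j) h x|)
              + 4 * (h x * |dd (ee i) (dd (ee j) h) x|) := by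
            simp [abs_mul, abs_of_nonneg (h0 x)]
        _ ≤ 12 * ((M / r) * (M / r)) + 4 * (1 * (M / r ^ 2)) := by
            have := b1 i x
            have := b1 j x
            have := b2 i j x
            have := h1 x
            gcongr
        _ = _ := by field_simp
    rw [mul_pow]
    have e2 : (12 * (dd (ee i) h x * dd (ee j) h x)
        + 4 * (h x * dd (ee i) (dd (ee j) h) x)) ^ 2 ≤ (12 * M ^ 2 + 4 * M) ^ 2 / r ^ 4 := by
      rw [← sq_abs]
      refine (pow_le_pow_left₀ (abs_nonneg _) e1 2).trans (le_of_eq ?_)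
      rw [div_pow]; ring
    calc _ ≤ (h x ^ 2) ^ 2 * ((12 * M ^ 2 + 4 * M) ^ 2 / r ^ 4) := by gcongr
      _ = (12 * M ^ 2 + 4 * M) ^ 2 / r ^ 4 * h x ^ 4 := by ring
      _ ≤ _ := by
          have := h0 x
          gcongr
          nlinarith [sq_nonneg M]

lemma slap_eq_s1 (n : ℕ) {u : EuclideanSpace ℝ (Fin n) × ℝ → ℝ} (hu : ContDiff ℝ (⊤ : ℕ∞) u) :
    slap n u = fun z => ∑ i, dd ((ee i, 0) : EuclideanSpace ℝ (Fin n) × ℝ)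
      (dd ((ee i, 0) : EuclideanSpace ℝ (Fin n) × ℝ) u) z := by
  funext z
  have : slap n u z = ∑ i, dd (ee i) (dd (ee i) (fun y => u (y, z.2))) z.1 := rfl
  rw [this]
  simp only [dd_dd_slice _ _ hu]

lemma slap_smooth (n : ℕ) {u : EuclideanSpace ℝ (Fin n) × ℝ → ℝ} (hu : ContDiff ℝ (⊤ : ℕ∞) u) :
    ContDiff ℝ (⊤ : ℕ∞) (slap n u) := by
  rw [slap_eq_s1 n hu]
  exact ContDiff.sum fun i _ => dd_smooth (dd_smooth hu)

lemma heat_int (n : ℕ) (p : EuclideanSpace ℝ (Fin n)) (r : ℝ)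
    {F : EuclideanSpace ℝ (Fin n) × ℝ → ℝ} (hF : Continuous F) :
    IntegrableOn F (heatBall n p r) := by
  have hc : IsCompact (closedBall p r ×ˢ Icc (-(r ^ 4)) (0 : ℝ)) :=
    (isCompact_closedBall p r).prod isCompact_Icc
  exact (hF.continuousOn.integrableOn_compact hc).mono_set
    (prod_mono ball_subset_closedBall subset_rfl)

lemma heat_int' (n : ℕ) (p : EuclideanSpace ℝ (Fin n)) (r : ℝ)
    {F : EuclideanSpace ℝ (Fin n) × ℝ → ℝ} (hF : Continuous F) :
    Integrable F ((volume.restrict (ball p r)).prod (volume.restrict (Icc (-(r ^ 4)) (0 : ℝ)))) := by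
  have := heat_int n p r hF
  rw [Measure.prod_restrict]
  exact this

lemma heat_eq (n : ℕ) (p : EuclideanSpace ℝ (Fin n)) (r : ℝ)
    (F : EuclideanSpace ℝ (Fin n) × ℝ → ℝ) :
    ∫ z in heatBall n p r, F z =
      ∫ z, F z ∂((volume.restrict (ball p r)).prod (volume.restrict (Icc (-(r ^ 4)) (0 : ℝ)))) := by
  rw [Measure.prod_restrict]
  rfl

lemma heat_fub1 (n : ℕ) (p : EuclideanSpace ℝ (Fin n)) (r : ℝ)
    {F : EuclideanSpace ℝ (Fin n) × ℝ → ℝ} (hF : Continuous F) :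
    ∫ z in heatBall n p r, F z = ∫ t in Icc (-(r ^ 4)) (0 : ℝ), ∫ x in ball p r, F (x, t) := by
  rw [heat_eq, integral_prod_symm _ (heat_int' n p r hF)]

lemma heat_fub2 (n : ℕ) (p : EuclideanSpace ℝ (Fin n)) (r : ℝ)
    {F : EuclideanSpace ℝ (Fin n) × ℝ → ℝ} (hF : Continuous F) :
    ∫ z in heatBall n p r, F z = ∫ x in ball p r, ∫ t in Icc (-(r ^ 4)) (0 : ℝ), F (x, t) := by
  rw [heat_eq, integral_prod _ (heat_int' n p r hF)]

lemma heat_meas (n : ℕ) (p : EuclideanSpace ℝ (Fin n)) (r : ℝ) :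
    MeasurableSet (heatBall n p r) := measurableSet_ball.prod measurableSet_Icc

lemma time_est {R : ℝ} (hR : 0 < R) {g : ℝ → ℝ} (hg : ContDiff ℝ (⊤ : ℕ∞) g) :
    ∫ t in Icc (-R) 0, ((t + R) / R) * (g t * (-(deriv g t))) ≤
      ∫ t in Icc (-R) 0, 1 / (2 * R) * g t ^ 2 := by
  have hgd : Differentiable ℝ g := hg.differentiable (by simp)
  have hg' : Continuous (deriv g) := hg.continuous_deriv (by simp)
  have hgc := hg.continuous
  have hle : -R ≤ 0 := by linarith
  rw [integral_Icc_eq_integral_Ioc, integral_Icc_eq_integral_Ioc,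
    ← intervalIntegral.integral_of_le hle, ← intervalIntegral.integral_of_le hle]
  have hder : ∀ t ∈ uIcc (-R) 0, HasDerivAt (fun t => ((t + R) / R) * (g t ^ 2 / 2))
      (1 / (2 * R) * g t ^ 2 - ((t + R) / R) * (g t * (-(deriv g t)))) t := by
    intro t _
    have h1 : HasDerivAt (fun t : ℝ => (t + R) / R) (1 / R) t :=
      ((hasDerivAt_id t).add_const R).div_const R
    have h2 := ((hgd t).hasDerivAt.pow 2).div_const 2
    refine (h1.mul h2).congr_deriv ?_
    simp only [Pi.pow_apply]
    push_cast
    field_simp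
    ring
  have c1 : Continuous (fun t : ℝ => 1 / (2 * R) * g t ^ 2) := by fun_prop
  have c2 : Continuous (fun t : ℝ => ((t + R) / R) * (g t * (-(deriv g t)))) := by fun_prop
  have key := intervalIntegral.integral_eq_sub_of_hasDerivAt hder
    ((c1.sub c2).intervalIntegrable _ _)
  rw [intervalIntegral.integral_sub (c1.intervalIntegrable _ _) (c2.intervalIntegrable _ _)] at key
  have : (0 : ℝ) ≤ (0 + R) / R * (g 0 ^ 2 / 2) := by positivity
  have h0 : (-R + R) / R * (g (-R) ^ 2 / 2) = 0 := by simp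
  linarith

lemma step2 (n : ℕ) (p : EuclideanSpace ℝ (Fin n)) {r : ℝ} (hr : 0 < r)
    {u : EuclideanSpace ℝ (Fin n) × ℝ → ℝ} (hu : ContDiff ℝ (⊤ : ℕ∞) u) (hb : BicaloricOn n u r)
    {ψ : EuclideanSpace ℝ (Fin n) → ℝ} (hψ : Continuous ψ) (h0 : ∀ x, 0 ≤ ψ x)
    (h1 : ∀ x, ψ x ≤ 1) :
    ∫ z in heatBall n p r, ((z.2 + r ^ 4) / r ^ 4) * (ψ z.1 * u z * slap n (slap n u) z) ≤
      ∫ z in heatBall n p r, 1 / (2 * r ^ 4) * u z ^ 2 := by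
  have hR : 0 < r ^ 4 := by positivity
  have hB : Continuous (slap n (slap n u)) := (slap_smooth n (slap_smooth n hu)).continuous
  have huc := hu.continuous
  have c1 : Continuous fun z : EuclideanSpace ℝ (Fin n) × ℝ =>
      ((z.2 + r ^ 4) / r ^ 4) * (ψ z.1 * u z * slap n (slap n u) z) := by fun_prop
  have c2 : Continuous fun z : EuclideanSpace ℝ (Fin n) × ℝ => 1 / (2 * r ^ 4) * u z ^ 2 := by
    fun_prop
  rw [heat_fub2 n p r c1, heat_fub2 n p r c2]
  refine integral_mono (heat_int' n p r c1).integral_prod_left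
    (heat_int' n p r c2).integral_prod_left fun x => ?_
  have e : ∫ t in Icc (-(r ^ 4)) (0 : ℝ),
      ((t + r ^ 4) / r ^ 4) * (ψ x * u (x, t) * slap n (slap n u) (x, t)) =
      ψ x * ∫ t in Icc (-(r ^ 4)) (0 : ℝ),
        ((t + r ^ 4) / r ^ 4) * (u (x, t) * (-(deriv (fun s => u (x, s)) t))) := by
    rw [← integral_const_mul]
    refine setIntegral_congr_fun measurableSet_Icc fun t ht => ?_
    have : deriv (fun s => u (x, s)) t + slap n (slap n u) (x, t) = 0 := hb x t ht
    have : slap n (slap n u) (x, t) = - deriv (fun s => u (x, s)) t := by linarith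
    simp only [this]
    ring
  simp only [e]
  have hs : ContDiff ℝ (⊤ : ℕ∞) (fun s => u (x, s)) :=
    hu.comp (contDiff_const.prodMk contDiff_id)
  have te := time_est hR hs
  have hnn : 0 ≤ ∫ t in Icc (-(r ^ 4)) (0 : ℝ), 1 / (2 * r ^ 4) * u (x, t) ^ 2 :=
    integral_nonneg fun t => by positivity
  calc _ ≤ ψ x * ∫ t in Icc (-(r ^ 4)) (0 : ℝ), 1 / (2 * r ^ 4) * u (x, t) ^ 2 :=
        mul_le_mul_of_nonneg_left te (h0 x)
    _ ≤ _ := mul_le_of_le_one_left hnn (h1 x)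

lemma step1 (n : ℕ) (p : EuclideanSpace ℝ (Fin n)) {r : ℝ}
    {u : EuclideanSpace ℝ (Fin n) × ℝ → ℝ} (hu : ContDiff ℝ (⊤ : ℕ∞) u)
    {ψ : EuclideanSpace ℝ (Fin n) → ℝ} (hψ : ContDiff ℝ (⊤ : ℕ∞) ψ) (hc : HasCompactSupport ψ)
    (hz : ∀ x, x ∉ ball p r → ψ x = 0)
    (hz1 : ∀ i x, x ∉ ball p r → dd (ee i) ψ x = 0)
    (hz2 : ∀ i j x, x ∉ ball p r → dd (ee i) (dd (ee j) ψ) x = 0) :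
    ∫ z in heatBall n p r, ((z.2 + r ^ 4) / r ^ 4) * (ψ z.1 * u z * slap n (slap n u) z) =
      ∫ z in heatBall n p r, ((z.2 + r ^ 4) / r ^ 4) * ∑ i, ∑ j,
        dd ((ee j, 0) : EuclideanSpace ℝ (Fin n) × ℝ)
          (dd ((ee i, 0) : EuclideanSpace ℝ (Fin n) × ℝ) (fun z => ψ z.1 * u z)) z *
        dd ((ee i, 0) : EuclideanSpace ℝ (Fin n) × ℝ)
          (dd ((ee j, 0) : EuclideanSpace ℝ (Fin n) × ℝ) u) z := by
  have hB : Continuous (slap n (slap n u)) := (slap_smooth n (slap_smooth n hu)).continuous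
  have huc := hu.continuous
  have hψc := hψ.continuous
  have hΦ : ContDiff ℝ (⊤ : ℕ∞) (fun z : EuclideanSpace ℝ (Fin n) × ℝ => ψ z.1 * u z) :=
    (hψ.comp contDiff_fst).mul hu
  have c1 : Continuous fun z : EuclideanSpace ℝ (Fin n) × ℝ =>
      ((z.2 + r ^ 4) / r ^ 4) * (ψ z.1 * u z * slap n (slap n u) z) := by fun_prop
  have c2 : Continuous fun z : EuclideanSpace ℝ (Fin n) × ℝ =>
      ((z.2 + r ^ 4) / r ^ 4) * ∑ i, ∑ j,
        dd ((ee j, 0) : EuclideanSpace ℝ (Fin n) × ℝ)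
          (dd ((ee i, 0) : EuclideanSpace ℝ (Fin n) × ℝ) (fun z => ψ z.1 * u z)) z *
        dd ((ee i, 0) : EuclideanSpace ℝ (Fin n) × ℝ)
          (dd ((ee j, 0) : EuclideanSpace ℝ (Fin n) × ℝ) u) z := by
    refine Continuous.mul (by fun_prop) ?_
    refine continuous_finsetSum _ fun i _ => continuous_finsetSum _ fun j _ => ?_
    exact (dd_smooth (dd_smooth hΦ)).continuous.mul (dd_smooth (dd_smooth hu)).continuous
  rw [heat_fub1 n p r c1, heat_fub1 n p r c2]
  congr 1
  funext t
  simp only [integral_const_mul]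
  congr 1
  have hw := smooth_slice hu t
  rw [setIntegral_eq_integral_of_forall_compl_eq_zero (fun x hx => by simp [hz x hx])]
  have := ibp_bilap n (hψ.mul hw) hw (hc.mul_right)
  refine Eq.trans this ?_
  have e1 : ∀ i j : Fin n, ∀ x,
      dd (ee j) (dd (ee i) (fun x => ψ x * u (x, t))) x =
      dd ((ee j, 0) : EuclideanSpace ℝ (Fin n) × ℝ)
          (dd ((ee i, 0) : EuclideanSpace ℝ (Fin n) × ℝ) (fun z => ψ z.1 * u z)) (x, t) :=
    fun i j x => congrFun (dd_dd_slice (ee j) (ee i) hΦ t) x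
  rw [setIntegral_eq_integral_of_forall_compl_eq_zero]
  · congr 1
    funext x
    refine Finset.sum_congr rfl fun i _ => Finset.sum_congr rfl fun j _ => ?_
    rw [← e1, dd_dd_slice (ee i) (ee j) hu t]
  · intro x hx
    refine Finset.sum_eq_zero fun i _ => Finset.sum_eq_zero fun j _ => ?_
    rw [← e1, dd_dd_mul _ _ hψ hw]
    simp [hz x hx, hz1 _ x hx, hz2 _ _ x hx]

lemma amgm {M s a b c : ℝ} (hs : 0 ≤ s) (hM : 0 ≤ M) (h : a ^ 2 ≤ M * s) :
    -(s * c ^ 2 / 8 + 2 * M * b ^ 2) ≤ a * b * c := by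
  have h1 : (a * b * c) ^ 2 ≤ (s * c ^ 2 / 8 + 2 * M * b ^ 2) ^ 2 := by
    have : (a * b * c) ^ 2 ≤ M * s * (b ^ 2 * c ^ 2) := by
      calc (a * b * c) ^ 2 = a ^ 2 * (b ^ 2 * c ^ 2) := by ring
        _ ≤ _ := by gcongr
    nlinarith [sq_nonneg (s * c ^ 2 / 8 - 2 * M * b ^ 2)]
  exact (abs_le.1 (abs_le_of_sq_le_sq h1 (by positivity))).1

lemma pointwise (n : ℕ) {M N s U : ℝ} (hs : 0 ≤ s) (hM : 0 ≤ M) (hN : 0 ≤ N)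
    (a v : Fin n → ℝ) (b w : Fin n → Fin n → ℝ) (hw : ∀ i j, w j i = w i j)
    (ha : ∀ i, a i ^ 2 ≤ M * s) (hb : ∀ i j, b i j ^ 2 ≤ N * s) :
    1 / 2 * (s * ∑ i, ∑ j, w i j ^ 2) - (4 * n * M * (∑ i, v i ^ 2) + 2 * n ^ 2 * N * U ^ 2) ≤
      ∑ i, ∑ j, (s * w j i + a j * v i + a i * v j + b j i * U) * w i j := by
  have h : ∀ i j, 1 / 2 * (s * w i j ^ 2) - (2 * M * v i ^ 2 + 2 * M * v j ^ 2 + 2 * N * U ^ 2) ≤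
      (s * w j i + a j * v i + a i * v j + b j i * U) * w i j := by
    intro i j
    rw [hw i j]
    have h1 := amgm (b := v i) (c := w i j) hs hM (ha j)
    have h2 := amgm (b := v j) (c := w i j) hs hM (ha i)
    have h3 := amgm (b := U) (c := w i j) hs hN (hb j i)
    have h4 : 0 ≤ s * w i j ^ 2 := by positivity
    nlinarith
  refine le_trans (le_of_eq ?_) (Finset.sum_le_sum fun i _ => Finset.sum_le_sum fun j _ => h i j)
  simp only [Finset.sum_sub_distrib, Finset.sum_add_distrib, ← Finset.mul_sum, Finset.sum_const,
    Finset.card_univ, Fintype.card_fin, nsmul_eq_mul]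
  ring

/-- **Hessian estimate for bicaloric functions** (Lemma 2.2, Euclidean case). -/
theorem hessian_estimate_bicaloric (n : ℕ) (hn : 1 ≤ n) (ε : ℝ) (hε : ε ∈ Set.Ioo (0 : ℝ) 1) :
    ∃ c : ℝ, 0 < c ∧
      ∀ (p : EuclideanSpace ℝ (Fin n)) (r : ℝ), 0 < r →
      ∀ u : EuclideanSpace ℝ (Fin n) × ℝ → ℝ, ContDiff ℝ (⊤ : ℕ∞) u → BicaloricOn n u r →
      r ^ 4 * (∫ z in heatBall n p (ε * r), shessNormSq n u z) ≤
      c * ((∫ z in heatBall n p r, (u z) ^ 2) +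
          r ^ 2 * ∫ z in heatBall n p r, ‖sgrad n u z‖ ^ 2) := by
  obtain ⟨K, hK, hcut⟩ := exists_cutoff n ε hε
  have hε4 : 0 < 1 - ε ^ 4 := by
    have : ε ^ 4 < 1 := pow_lt_one₀ hε.1.le hε.2 (by norm_num)
    linarith
  refine ⟨2 * (2 * n ^ 2 * K + 4 * n * K + 1) / (1 - ε ^ 4), by positivity, ?_⟩
  intro p r hr u hu hb
  obtain ⟨ψ, hψ, hψc, h0, h1, hone, hz, hd1, hd2⟩ := hcut p r hr
  have hz1 : ∀ i x, x ∉ ball p r → dd (ee i) ψ x = 0 := by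
    intro i x hx
    have := hd1 i x
    rw [hz x hx, mul_zero] at this
    exact pow_eq_zero_iff (two_ne_zero) |>.1 (le_antisymm this (sq_nonneg _))
  have hz2 : ∀ i j x, x ∉ ball p r → dd (ee i) (dd (ee j) ψ) x = 0 := by
    intro i j x hx
    have := hd2 i j x
    rw [hz x hx, mul_zero] at this
    exact pow_eq_zero_iff (two_ne_zero) |>.1 (le_antisymm this (sq_nonneg _))
  have s1 := step1 n p hu hψ hψc hz hz1 hz2
  have s2 := step2 n p hr hu hb hψ.continuous h0 h1
  rw [s1] at s2
  have huc := hu.continuous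
  have hψcont := hψ.continuous
  have hP : ContDiff ℝ (⊤ : ℕ∞) (fun z : EuclideanSpace ℝ (Fin n) × ℝ => ψ z.1) :=
    hψ.comp contDiff_fst
  have hΦ : ContDiff ℝ (⊤ : ℕ∞) (fun z : EuclideanSpace ℝ (Fin n) × ℝ => ψ z.1 * u z) :=
    hP.mul hu
  have hHc : Continuous (shessNormSq n u) := by
    rw [funext (shess_eq_s1 n u hu)]
    exact continuous_finsetSum _ fun i _ => continuous_finsetSum _ fun j _ =>
      (dd_smooth (dd_smooth hu)).continuous.pow 2
  have hGc : Continuous (fun z => ‖sgrad n u z‖ ^ 2) := by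
    rw [funext (norm_sgrad_sq n u hu)]
    exact continuous_finsetSum _ fun i _ => (dd_smooth hu).continuous.pow 2
  have hH0 : ∀ z, 0 ≤ shessNormSq n u z := by
    intro z
    rw [shess_eq_s1 n u hu]
    positivity
  have cS : Continuous fun z : EuclideanSpace ℝ (Fin n) × ℝ =>
      ((z.2 + r ^ 4) / r ^ 4) * ∑ i, ∑ j,
        dd ((ee j, 0) : EuclideanSpace ℝ (Fin n) × ℝ)
          (dd ((ee i, 0) : EuclideanSpace ℝ (Fin n) × ℝ) (fun z => ψ z.1 * u z)) z *
        dd ((ee i, 0) : EuclideanSpace ℝ (Fin n) × ℝ)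
          (dd ((ee j, 0) : EuclideanSpace ℝ (Fin n) × ℝ) u) z := by
    refine Continuous.mul (by fun_prop) ?_
    refine continuous_finsetSum _ fun i _ => continuous_finsetSum _ fun j _ => ?_
    exact (dd_smooth (dd_smooth hΦ)).continuous.mul (dd_smooth (dd_smooth hu)).continuous
  have cL : Continuous fun z : EuclideanSpace ℝ (Fin n) × ℝ =>
      ((z.2 + r ^ 4) / r ^ 4) * (ψ z.1 * shessNormSq n u z) := by fun_prop
  have hpt : ∀ z ∈ heatBall n p r,
      1 / 2 * (((z.2 + r ^ 4) / r ^ 4) * (ψ z.1 * shessNormSq n u z))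
        - (4 * n * (K / r ^ 2) * ‖sgrad n u z‖ ^ 2 + 2 * n ^ 2 * (K / r ^ 4) * u z ^ 2) ≤
      ((z.2 + r ^ 4) / r ^ 4) * ∑ i, ∑ j,
        dd ((ee j, 0) : EuclideanSpace ℝ (Fin n) × ℝ)
          (dd ((ee i, 0) : EuclideanSpace ℝ (Fin n) × ℝ) (fun z => ψ z.1 * u z)) z *
        dd ((ee i, 0) : EuclideanSpace ℝ (Fin n) × ℝ)
          (dd ((ee j, 0) : EuclideanSpace ℝ (Fin n) × ℝ) u) z := by
    rintro ⟨x, t⟩ ⟨-, ht1, ht2⟩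
    simp only at ht1 ht2 ⊢
    have hR : 0 < r ^ 4 := by positivity
    have hχ0 : 0 ≤ (t + r ^ 4) / r ^ 4 := div_nonneg (by linarith) hR.le
    have hχ1 : (t + r ^ 4) / r ^ 4 ≤ 1 := by rw [div_le_one hR]; linarith
    have e1 : ∀ i : Fin n, dd ((ee i, 0) : EuclideanSpace ℝ (Fin n) × ℝ)
        (fun z : EuclideanSpace ℝ (Fin n) × ℝ => ψ z.1) (x, t) = dd (ee i) ψ x :=
      fun i => (congrFun (dd_slice (ee i) hP t) x).symm
    have e2 : ∀ i j : Fin n, dd ((ee i, 0) : EuclideanSpace ℝ (Fin n) × ℝ)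
        (dd ((ee j, 0) : EuclideanSpace ℝ (Fin n) × ℝ)
        (fun z : EuclideanSpace ℝ (Fin n) × ℝ => ψ z.1)) (x, t) = dd (ee i) (dd (ee j) ψ) x :=
      fun i j => (congrFun (dd_dd_slice (ee i) (ee j) hP t) x).symm
    have pw := pointwise n (M := K / r ^ 2) (N := K / r ^ 4) (s := ψ x) (U := u (x, t)) (h0 x)
      (by positivity) (by positivity)
      (fun i => dd (ee i) ψ x) (fun i => dd ((ee i, 0) : EuclideanSpace ℝ (Fin n) × ℝ) u (x, t))
      (fun i j => dd (ee i) (dd (ee j) ψ) x)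
      (fun i j => dd ((ee i, 0) : EuclideanSpace ℝ (Fin n) × ℝ)
          (dd ((ee j, 0) : EuclideanSpace ℝ (Fin n) × ℝ) u) (x, t))
      (fun i j => congrFun (dd_comm _ _ hu) _) (fun i => hd1 i x) (fun i j => hd2 i j x)
    rw [← shess_eq_s1 n u hu, ← norm_sgrad_sq n u hu] at pw
    simp only [dd_dd_mul _ _ hP hu, e1, e2]
    have hnn : 0 ≤ 4 * n * (K / r ^ 2) * ‖sgrad n u (x, t)‖ ^ 2
        + 2 * n ^ 2 * (K / r ^ 4) * u (x, t) ^ 2 := by positivity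
    refine le_trans ?_ (mul_le_mul_of_nonneg_left pw hχ0)
    nlinarith [mul_le_of_le_one_left hnn hχ1]
  have iL := heat_int n p r cL
  have iG := heat_int n p r hGc
  have iU := heat_int n p r (huc.pow 2)
  have hmono := setIntegral_mono_on
    ((iL.const_mul (1 / 2)).sub ((iG.const_mul (4 * n * (K / r ^ 2))).add
      (iU.const_mul (2 * n ^ 2 * (K / r ^ 4))))) (heat_int n p r cS) (heat_meas n p r) hpt
  have hint : ∫ z in heatBall n p r,
      (1 / 2 * (((z.2 + r ^ 4) / r ^ 4) * (ψ z.1 * shessNormSq n u z))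
        - (4 * n * (K / r ^ 2) * ‖sgrad n u z‖ ^ 2 + 2 * n ^ 2 * (K / r ^ 4) * u z ^ 2)) =
      1 / 2 * (∫ z in heatBall n p r, ((z.2 + r ^ 4) / r ^ 4) * (ψ z.1 * shessNormSq n u z))
        - (4 * n * (K / r ^ 2) * (∫ z in heatBall n p r, ‖sgrad n u z‖ ^ 2)
          + 2 * n ^ 2 * (K / r ^ 4) * ∫ z in heatBall n p r, u z ^ 2) := by
    rw [← integral_const_mul, ← integral_const_mul, ← integral_const_mul, ← integral_add,
      ← integral_sub]
    · exact iL.const_mul (1 / 2)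
    · exact (iG.const_mul (4 * n * (K / r ^ 2))).add (iU.const_mul (2 * n ^ 2 * (K / r ^ 4)))
    · exact iG.const_mul _
    · exact iU.const_mul _
  have hsub : heatBall n p (ε * r) ⊆ heatBall n p r := by
    have hle : ε * r ≤ r := mul_le_of_le_one_left hr.le hε.2.le
    have h4 : (ε * r) ^ 4 ≤ r ^ 4 := pow_le_pow_left₀ (mul_pos hε.1 hr).le hle 4
    exact prod_mono (ball_subset_ball hle) (Icc_subset_Icc (by linarith) le_rfl)
  have hlow : (1 - ε ^ 4) * (∫ z in heatBall n p (ε * r), shessNormSq n u z) ≤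
      ∫ z in heatBall n p r, ((z.2 + r ^ 4) / r ^ 4) * (ψ z.1 * shessNormSq n u z) := by
    rw [← integral_const_mul]
    calc _ ≤ ∫ z in heatBall n p (ε * r),
          ((z.2 + r ^ 4) / r ^ 4) * (ψ z.1 * shessNormSq n u z) := by
          refine setIntegral_mono_on ((heat_int n p _ hHc).const_mul _) (heat_int n p _ cL)
            (heat_meas n p _) ?_
          rintro ⟨x, t⟩ ⟨hx, ht1, ht2⟩
          simp only at hx ht1 ht2 ⊢
          rw [hone x hx, one_mul]
          refine mul_le_mul_of_nonneg_right ?_ (hH0 _)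
          rw [le_div_iff₀ (by positivity)]
          rw [mul_pow] at ht1
          linarith
      _ ≤ _ := by
          refine setIntegral_mono_set iL ?_ (Filter.Eventually.of_forall hsub)
          refine (ae_restrict_iff' (heat_meas n p r)).2 (Filter.Eventually.of_forall ?_)
          rintro ⟨x, t⟩ ⟨hx, ht1, ht2⟩
          simp only [Pi.zero_apply] at ht1 ht2 ⊢
          exact mul_nonneg (div_nonneg (by linarith) (by positivity))
            (mul_nonneg (h0 _) (hH0 _))
  have hG0 : 0 ≤ ∫ z in heatBall n p r, ‖sgrad n u z‖ ^ 2 := integral_nonneg fun z => sq_nonneg _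
  have hU0 : 0 ≤ ∫ z in heatBall n p r, u z ^ 2 := integral_nonneg fun z => sq_nonneg _
  rw [integral_const_mul] at s2
  have hfin := (hint.symm.le.trans hmono).trans s2
  generalize (∫ z in heatBall n p r, ‖sgrad n u z‖ ^ 2) = G at *
  generalize (∫ z in heatBall n p r, u z ^ 2) = U at *
  generalize (∫ z in heatBall n p r,
    ((z.2 + r ^ 4) / r ^ 4) * (ψ z.1 * shessNormSq n u z)) = A at *
  generalize (∫ z in heatBall n p (ε * r), shessNormSq n u z) = H at *
  have h5 : (1 - ε ^ 4) * H ≤ 8 * n * (K / r ^ 2) * G + 4 * n ^ 2 * (K / r ^ 4) * U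
      + 1 / r ^ 4 * U := by
    have : 1 / (2 * r ^ 4) * U = 1 / 2 * (1 / r ^ 4 * U) := by field_simp
    linarith
  have h6 : r ^ 4 * ((1 - ε ^ 4) * H) ≤ 8 * n * K * (r ^ 2 * G) + 4 * n ^ 2 * K * U + U := by
    refine (mul_le_mul_of_nonneg_left h5 (by positivity)).trans (le_of_eq ?_)
    field_simp
  rw [div_mul_eq_mul_div, le_div_iff₀ hε4]
  have q1 : 0 ≤ (n : ℝ) ^ 2 * K * (r ^ 2 * G) := by positivity
  have q2 : 0 ≤ (n : ℝ) * K * U := by positivity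
  have q3 : 0 ≤ r ^ 2 * G := by positivity
  nlinarith
end
end
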